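/- arXiv:0912.5028 — 5 statements merged into one kernel-verified Lean document; each statement's English description precedes it below -/
import Mathlib

section
/- Let V be a finite-dimensional real inner product space, G a group of linear isometries of V, o ⊆ V a G-orbit whose linear span is all of V, and W′ a subgroup of G. Then the fixed subspace of W′, namely {v ∈ V : w v = v for all w ∈ W′}, equals the orthogonal complement of the linear span of the set of all vectors x − y, where x, y ∈ o lie in the same W′-orbit. -/
/-- Let `V` be a finite-dimensional real inner product space, `G` a group of
linear isometries of `V`, `o ⊆ V` a `G`-orbit whose linear span is all of `V`, and `W'` a
subgroup of `G`.  Then the fixed subspace of `W'` equals the orthogonal complement of the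
linear span of all vectors `x - y` where `x, y ∈ o` lie in the same `W'`-orbit. -/
theorem fixed_subspace_eq_orthogonal_span_of_orbit_partition
    {V : Type*} [NormedAddCommGroup V] [InnerProductSpace ℝ V] [FiniteDimensional ℝ V]
    (G : Subgroup (V ≃ₗᵢ[ℝ] V))
    (o : Set V) (v₀ : V) (ho : o = {x : V | ∃ g ∈ G, g v₀ = x})
    (hspan : Submodule.span ℝ o = ⊤)
    (W' : Subgroup (V ≃ₗᵢ[ℝ] V)) (hW' : W' ≤ G) :
    {v : V | ∀ w ∈ W', w v = v} =
      ((Submodule.span ℝ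
        {d : V | ∃ x ∈ o, ∃ y ∈ o, (∃ w ∈ W', w x = y) ∧ d = x - y})ᗮ : Set V) := by
  have hmem : ∀ w ∈ W', ∀ x ∈ o, w x ∈ o := by
    subst ho
    rintro w hw _ ⟨g, hg, rfl⟩
    exact ⟨w * g, G.mul_mem (hW' hw) hg, rfl⟩
  ext v
  simp only [Set.mem_ofPred_eq, SetLike.mem_coe]
  constructor
  · intro hv
    rw [← Submodule.span_singleton_le_iff_mem, Submodule.le_orthogonal_iff_le_orthogonal,
      Submodule.span_le]
    rintro _ ⟨x, -, _, -, ⟨w, hw, rfl⟩, rfl⟩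
    have h : inner ℝ v (w x) = inner ℝ v x := by
      conv_lhs => rw [← hv w hw]
      exact w.inner_map_map v x
    rw [SetLike.mem_coe, Submodule.mem_orthogonal_singleton_iff_inner_right, inner_sub_right, h,
      sub_self]
  · intro hv w hw
    have hinner : innerₛₗ ℝ (w v) = innerₛₗ ℝ v := by
      refine LinearMap.ext_on hspan fun x hx => ?_
      have hw' : w⁻¹ ∈ W' := W'.inv_mem hw
      have h : inner ℝ v (x - w⁻¹ x) = 0 := by
        refine Submodule.inner_left_of_mem_orthogonal (Submodule.subset_span ?_) hv
        exact ⟨x, hx, w⁻¹ x, hmem _ hw' x hx, ⟨w⁻¹, hw', rfl⟩, rfl⟩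
      rw [inner_sub_right, sub_eq_zero] at h
      have hx' : w (w⁻¹ x) = x := w.apply_symm_apply x
      calc inner ℝ (w v) x = inner ℝ (w v) (w (w⁻¹ x)) := by rw [hx']
        _ = inner ℝ v (w⁻¹ x) := w.inner_map_map _ _
        _ = inner ℝ v x := h.symm
    exact ext_inner_right ℝ fun x => LinearMap.congr_fun hinner x
end

section
/- Let V be a finite-dimensional real inner product space, G a group of linear isometries of V, and o ⊆ V a G-orbit whose linear span is all of V. Suppose W₁ and W₂ are subgroups of G such that, for i = 1, 2, Wᵢ equals the subgroup of all elements of G that fix the subspace Fix(Wᵢ) = {v ∈ V : w v = v for all w ∈ Wᵢ} pointwise. If the partition of o into W₁-orbits coincides with the partition of o into W₂-orbits, then W₁ = W₂. -/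
open scoped RealInnerProductSpace

/-- A vector is fixed by a group of linear isometries as soon as pairing with it is invariant on a
spanning set. -/
lemma forall_mem_apply_eq_iff_inner_eq
    {V : Type*} [NormedAddCommGroup V] [InnerProductSpace ℝ V]
    {o : Set V} (hspan : Submodule.span ℝ o = ⊤) (W : Subgroup (V ≃ₗᵢ[ℝ] V)) (v : V) :
    (∀ w ∈ W, w v = v) ↔ ∀ x ∈ o, ∀ y, (∃ w ∈ W, w x = y) → ⟪y, v⟫ = ⟪x, v⟫ := by
  constructor
  · rintro h x - _ ⟨w, hw, rfl⟩
    conv_lhs => rw [← h w hw]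
    exact w.inner_map_map x v
  · intro h w hw
    refine ext_inner_left ℝ fun z => ?_
    have hz : z ∈ Submodule.span ℝ o := hspan ▸ Submodule.mem_top
    induction hz using Submodule.span_induction with
    | mem x hx =>
      have hinv := h x hx (w⁻¹ x) ⟨w⁻¹, W.inv_mem hw, rfl⟩
      rw [← hinv, ← w.inner_map_map (w⁻¹ x) v]
      exact congrArg (fun u => ⟪u, w v⟫) (w.apply_symm_apply x).symm
    | zero => simp
    | add x y _ _ hx hy => rw [inner_add_left, inner_add_left, hx, hy]
    | smul a x _ hx => rw [real_inner_smul_left, real_inner_smul_left, hx]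

/-- Let `V` be a finite-dimensional real inner product space, `G` a group of
linear isometries of `V`, and `o ⊆ V` a `G`-orbit spanning `V`.  If `W₁`, `W₂` are subgroups
of `G`, each equal to the subgroup of all elements of `G` fixing its fixed subspace pointwise,
and the partitions of `o` into `W₁`-orbits and into `W₂`-orbits coincide, then `W₁ = W₂`. -/
theorem subgroup_eq_of_orbit_partitions_eq
    {V : Type*} [NormedAddCommGroup V] [InnerProductSpace ℝ V] [FiniteDimensional ℝ V]
    (G : Subgroup (V ≃ₗᵢ[ℝ] V))
    (o : Set V) (v₀ : V) (ho : o = {x : V | ∃ g ∈ G, g v₀ = x})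
    (hspan : Submodule.span ℝ o = ⊤)
    (W₁ W₂ : Subgroup (V ≃ₗᵢ[ℝ] V)) (hW₁le : W₁ ≤ G) (hW₂le : W₂ ≤ G)
    (hW₁ : ∀ g : V ≃ₗᵢ[ℝ] V,
      g ∈ W₁ ↔ (g ∈ G ∧ ∀ v : V, (∀ w ∈ W₁, w v = v) → g v = v))
    (hW₂ : ∀ g : V ≃ₗᵢ[ℝ] V,
      g ∈ W₂ ↔ (g ∈ G ∧ ∀ v : V, (∀ w ∈ W₂, w v = v) → g v = v))
    (hpart : ∀ x ∈ o, ∀ y ∈ o, (∃ w ∈ W₁, w x = y) ↔ (∃ w ∈ W₂, w x = y)) :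
    W₁ = W₂ := by
  have hmem : ∀ {W : Subgroup (V ≃ₗᵢ[ℝ] V)}, W ≤ G → ∀ x ∈ o, ∀ y,
      (∃ w ∈ W, w x = y) → y ∈ o := by
    subst ho
    rintro W hW _ ⟨g, hg, rfl⟩ _ ⟨w, hw, rfl⟩
    exact ⟨w * g, G.mul_mem (hW hw) hg, rfl⟩
  have hfix : ∀ v : V, (∀ w ∈ W₁, w v = v) ↔ ∀ w ∈ W₂, w v = v := by
    intro v
    rw [forall_mem_apply_eq_iff_inner_eq hspan, forall_mem_apply_eq_iff_inner_eq hspan]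
    exact ⟨fun h x hx y hy => h x hx y ((hpart x hx y (hmem hW₂le x hx y hy)).2 hy),
      fun h x hx y hy => h x hx y ((hpart x hx y (hmem hW₁le x hx y hy)).1 hy)⟩
  ext g
  rw [hW₁, hW₂]
  simp only [hfix]
end

section
/- For any reflection t ∈ T, the orbit of t under the conjugation action of the subgroup D = ⟨c₊, c₋⟩ satisfies exactly one of the following: (i) it has h/2 elements (in particular h is even in this case) and contains exactly one simple reflection s ∈ S, and this s satisfies w₀ s w₀⁻¹ = s; or (ii) it has h elements and contains exactly two simple reflections s, s′ ∈ S, and these satisfy w₀ s w₀⁻¹ = s′. -/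
open CoxeterSystem

/-! ### The geometric representation of a Coxeter group -/

namespace CoxeterMatrix

variable {B : Type*} (M : CoxeterMatrix B)

/-- The weight `2 cos (π / M i j)`; it equals `-2` on the diagonal, and `2` when `M i j = 0`. -/
noncomputable def weight (i j : B) : ℝ := 2 * Real.cos (Real.pi / M i j)

lemma weight_self (i : B) : M.weight i i = -2 := by
  simp [weight]

lemma weight_comm (i j : B) : M.weight i j = M.weight j i := by
  rw [weight, weight, M.symmetric]

lemma angle_le_half_pi {i j : B} (h : i ≠ j) : Real.pi / M i j ≤ Real.pi / 2 := by
  have h1 := M.off_diagonal i j h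
  rcases Nat.eq_zero_or_pos (M i j) with h0 | h0
  · rw [h0]; simp; positivity
  · have : (2 : ℝ) ≤ M i j := by exact_mod_cast (by omega : 2 ≤ M i j)
    exact div_le_div_of_nonneg_left Real.pi_pos.le (by norm_num) this

lemma weight_nonneg {i j : B} (h : i ≠ j) : 0 ≤ M.weight i j := by
  have : 0 ≤ Real.pi / M i j := by positivity
  have := M.angle_le_half_pi h
  refine mul_nonneg (by norm_num) (Real.cos_nonneg_of_mem_Icc ⟨?_, this⟩)
  linarith [Real.pi_pos]

lemma eq_two_of_weight_eq_zero {i j : B} (hw : M.weight i j = 0) : M i j = 2 := by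
  have h : i ≠ j := by rintro rfl; rw [weight_self] at hw; norm_num at hw
  have hn : 0 ≤ Real.pi / M i j := by positivity
  have hle := M.angle_le_half_pi h
  have hc : Real.cos (Real.pi / M i j) = 0 := by simpa [weight] using hw
  have hge : Real.pi / 2 ≤ Real.pi / M i j := by
    by_contra! hlt
    exact (Real.cos_pos_of_mem_Ioo ⟨by linarith [Real.pi_pos], hlt⟩).ne' hc
  have heq := le_antisymm hle hge
  have h0 : (M i j : ℝ) ≠ 0 := by
    intro h0
    rw [h0, div_zero] at heq
    linarith [Real.pi_pos]
  field_simp at heq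
  exact_mod_cast heq.symm

variable [Fintype B] [DecidableEq B]

/-- The linear form `x ↦ ∑ j, weight i j * x j` defining the `i`-th simple reflection. -/
noncomputable def rootForm (i : B) : (B → ℝ) →ₗ[ℝ] ℝ :=
  ∑ j, M.weight i j • LinearMap.proj j

omit [DecidableEq B] in
lemma rootForm_apply (i : B) (x : B → ℝ) : M.rootForm i x = ∑ j, M.weight i j * x j := by
  simp [rootForm]

lemma rootForm_single (i j : B) : M.rootForm i (Pi.single j 1) = M.weight i j := by
  simp [rootForm_apply, Pi.single_apply]

/-- The `i`-th simple reflection acting on `B → ℝ`. -/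
noncomputable def simpleEnd (i : B) : Module.End ℝ (B → ℝ) :=
  LinearMap.id + (M.rootForm i).smulRight (Pi.single i 1)

lemma simpleEnd_apply (i : B) (x : B → ℝ) :
    M.simpleEnd i x = x + M.rootForm i x • Pi.single i 1 := by
  simp [simpleEnd]

lemma simpleEnd_mul_self (i : B) : M.simpleEnd i * M.simpleEnd i = 1 := by
  ext1 j
  ext1
  simp only [LinearMap.comp_apply, Module.End.mul_apply, simpleEnd_apply, map_add, map_smul,
    rootForm_single, weight_self, Module.End.one_apply]
  module

/-- A vector of the plane spanned by `i` and `j`, rotated by `simpleEnd i * simpleEnd j`. -/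
noncomputable def planeVec (i j : B) (φ : ℝ) : B → ℝ :=
  Real.sin (φ + Real.pi / M i j) • Pi.single i 1 + Real.sin φ • Pi.single j 1

lemma simpleEnd_mul_pow_planeVec (i j : B) (k : ℕ) (φ : ℝ) :
    ((M.simpleEnd i * M.simpleEnd j) ^ k) (M.planeVec i j φ)
      = M.planeVec i j (φ + 2 * k * (Real.pi / M i j)) := by
  induction k with
  | zero => simp
  | succ k ih =>
    rw [pow_succ', Module.End.mul_apply, ih]
    have hji : M.weight j i = 2 * Real.cos (Real.pi / M i j) := by rw [M.weight_comm, weight]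
    have hij : M.weight i j = 2 * Real.cos (Real.pi / M i j) := rfl
    set θ := Real.pi / M i j
    set ψ := φ + 2 * k * θ
    have h1 : Real.sin (ψ + 2 * θ) = 2 * Real.cos θ * Real.sin (ψ + θ) - Real.sin ψ := by
      have e1 : ψ + 2 * θ = (ψ + θ) + θ := by ring
      have e2 : Real.sin ψ = Real.sin ((ψ + θ) - θ) := by ring_nf
      rw [e1, e2, Real.sin_add (ψ + θ), Real.sin_sub (ψ + θ)]; ring
    have h2 : Real.sin (ψ + 2 * θ + θ)
        = 2 * Real.cos θ * Real.sin (ψ + 2 * θ) - Real.sin (ψ + θ) := by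
      have e2 : Real.sin (ψ + θ) = Real.sin ((ψ + 2 * θ) - θ) := by ring_nf
      rw [e2, Real.sin_add (ψ + 2 * θ), Real.sin_sub (ψ + 2 * θ)]; ring
    have h3 : φ + 2 * ((k + 1 : ℕ) : ℝ) * θ = ψ + 2 * θ := by simp only [ψ]; push_cast; ring
    rw [h3]
    simp only [planeVec, Module.End.mul_apply, simpleEnd_apply, map_add, map_smul,
      rootForm_single, weight_self, hij, hji]
    change _ = Real.sin (ψ + 2 * θ + θ) • _ + _
    rw [h2, h1]
    module

lemma isLiftable_simpleEnd : M.IsLiftable M.simpleEnd := by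
  intro i j
  rcases eq_or_ne i j with rfl | h
  · simp [simpleEnd_mul_self]
  rcases Nat.eq_zero_or_pos (M i j) with h0 | h0
  · simp [h0]
  have h1 := M.off_diagonal i j h
  have hm : (2 : ℝ) ≤ M i j := by exact_mod_cast (by omega : 2 ≤ M i j)
  have hpos : 0 < Real.pi / M i j := div_pos Real.pi_pos (by linarith)
  have hle := M.angle_le_half_pi h
  have hsin : 0 < Real.sin (Real.pi / M i j) :=
    Real.sin_pos_of_pos_of_lt_pi hpos (by linarith [Real.pi_pos])
  have hplane (φ : ℝ) : ((M.simpleEnd i * M.simpleEnd j) ^ M i j) (M.planeVec i j φ)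
      = M.planeVec i j φ := by
    rw [simpleEnd_mul_pow_planeVec]
    have : φ + 2 * M i j * (Real.pi / M i j) = φ + 2 * Real.pi := by
      field_simp
    rw [this, planeVec, planeVec, Real.sin_add_two_pi, add_right_comm, Real.sin_add_two_pi]
  have hi : ((M.simpleEnd i * M.simpleEnd j) ^ M i j) (Pi.single i 1) = Pi.single i 1 := by
    have := hplane 0
    simp only [planeVec, zero_add, Real.sin_zero, zero_smul, add_zero, map_smul] at this
    exact smul_right_injective _ hsin.ne' this
  have hj : ((M.simpleEnd i * M.simpleEnd j) ^ M i j) (Pi.single j 1) = Pi.single j 1 := by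
    have := hplane (-(Real.pi / M i j))
    simp only [planeVec, neg_add_cancel, Real.sin_zero, zero_smul, zero_add, map_smul,
      Real.sin_neg] at this
    exact smul_right_injective _ (neg_ne_zero.2 hsin.ne') this
  have hfix (k : ℕ) (x : B → ℝ) (hxi : M.rootForm i x = 0) (hxj : M.rootForm j x = 0) :
      ((M.simpleEnd i * M.simpleEnd j) ^ k) x = x := by
    induction k with
    | zero => simp
    | succ k ih => rw [pow_succ', Module.End.mul_apply, ih]; simp [simpleEnd_apply, hxi, hxj]
  refine LinearMap.ext fun x ↦ ?_
  have hji : M.weight j i = 2 * Real.cos (Real.pi / M i j) := by rw [M.weight_comm, weight]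
  have hij : M.weight i j = 2 * Real.cos (Real.pi / M i j) := rfl
  have hcs := Real.sin_sq_add_cos_sq (Real.pi / M i j)
  set c := Real.cos (Real.pi / M i j)
  set d := Real.sin (Real.pi / M i j)
  set f := M.rootForm i x
  set g := M.rootForm j x
  set p := -(f + c * g) / (2 * d ^ 2) with hp
  set q := -(g + c * f) / (2 * d ^ 2) with hq
  have hx : x = (x - (p • Pi.single i 1 + q • Pi.single j 1))
      + (p • Pi.single i 1 + q • Pi.single j 1) := by abel
  have hc2 : c ^ 2 = 1 - d ^ 2 := by linarith
  rw [hx, map_add, hfix, map_add, map_smul, map_smul, hi, hj, Module.End.one_apply]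
  · simp only [map_sub, map_add, map_smul, rootForm_single, weight_self, smul_eq_mul, hij]
    change f - _ = 0
    rw [hp, hq]
    field_simp
    linear_combination f * hc2
  · simp only [map_sub, map_add, map_smul, rootForm_single, weight_self, smul_eq_mul, hji]
    change g - _ = 0
    rw [hp, hq]
    field_simp
    linear_combination g * hc2

/-- The symmetric bilinear form preserved by the simple reflections. -/
noncomputable def form (x y : B → ℝ) : ℝ := ∑ i, x i * M.rootForm i y

omit [DecidableEq B] in
lemma form_comm (x y : B → ℝ) : M.form x y = M.form y x := by
  simp only [form, rootForm_apply, Finset.mul_sum]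
  rw [Finset.sum_comm]
  refine Finset.sum_congr rfl fun i _ ↦ Finset.sum_congr rfl fun j _ ↦ ?_
  rw [M.weight_comm]; ring

omit [DecidableEq B] in
lemma form_add_left (x x' y : B → ℝ) : M.form (x + x') y = M.form x y + M.form x' y := by
  simp [form, add_mul, Finset.sum_add_distrib]

omit [DecidableEq B] in
lemma form_smul_left (r : ℝ) (x y : B → ℝ) : M.form (r • x) y = r * M.form x y := by
  simp [form, Finset.mul_sum, mul_assoc]

lemma form_single_left (i : B) (y : B → ℝ) : M.form (Pi.single i 1) y = M.rootForm i y := by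
  simp [form, Pi.single_apply]

lemma form_simpleEnd (i : B) (x y : B → ℝ) :
    M.form (M.simpleEnd i x) (M.simpleEnd i y) = M.form x y := by
  have h (x : B → ℝ) : M.form x (Pi.single i 1) = M.rootForm i x := by
    rw [form_comm, form_single_left]
  rw [simpleEnd_apply, simpleEnd_apply, form_add_left, form_smul_left, form_comm _ x,
    form_comm _ (Pi.single i 1), form_add_left, form_add_left, form_smul_left, form_smul_left,
    form_single_left, form_single_left, rootForm_single, weight_self, form_comm _ y x, h]
  ring

end CoxeterMatrix

/-- Products `⋯ L (!b) L b` of `k` alternating factors, the rightmost one being `L b`. -/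
def altProd {G : Type*} [Monoid G] (L : Bool → G) (b : Bool) : ℕ → G
  | 0 => 1
  | k + 1 => L (xor b k.bodd) * altProd L b k

lemma altProd_succ' {G : Type*} [Monoid G] (L : Bool → G) (b : Bool) (k : ℕ) :
    altProd L b (k + 1) = altProd L (!b) k * L b := by
  induction k with
  | zero => simp [altProd]
  | succ k ih =>
    rw [altProd, ih, altProd, mul_assoc]
    simp

lemma altProd_two_mul {G : Type*} [Monoid G] (L : Bool → G) (b : Bool) (k : ℕ) :
    altProd L b (2 * k) = (L (!b) * L b) ^ k := by
  induction k with
  | zero => simp [altProd]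
  | succ k ih =>
    rw [show 2 * (k + 1) = 2 * k + 1 + 1 by ring, altProd, altProd, ih, pow_succ', mul_assoc]
    simp

/-- The sequence `0, 1, μ, μ² - 1, …` of Chebyshev type. -/
noncomputable def chebSeq (μ : ℝ) : ℕ → ℝ
  | 0 => 0
  | 1 => 1
  | k + 2 => μ * chebSeq μ (k + 1) - chebSeq μ k

lemma chebSeq_mul_sin (θ : ℝ) (k : ℕ) :
    chebSeq (2 * Real.cos θ) k * Real.sin θ = Real.sin (k * θ) := by
  induction k using Nat.twoStepInduction with
  | zero => simp [chebSeq]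
  | one => simp [chebSeq]
  | more k h1 h2 =>
    have e1 : ((k + 2 : ℕ) : ℝ) * θ = ((k + 1 : ℕ) : ℝ) * θ + θ := by push_cast; ring
    have e2 : Real.sin ((k : ℝ) * θ) = Real.sin (((k + 1 : ℕ) : ℝ) * θ - θ) := by
      congr 1; push_cast; ring
    rw [chebSeq, sub_mul, h1, e1, e2, Real.sin_add, Real.sin_sub, mul_assoc, h2]
    ring

lemma chebSeq_two (k : ℕ) : chebSeq 2 k = k := by
  induction k using Nat.twoStepInduction with
  | zero => simp [chebSeq]
  | one => simp [chebSeq]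
  | more k h1 h2 => rw [chebSeq, h1, h2]; push_cast; ring

lemma CoxeterMatrix.chebSeq_weight_nonneg {B : Type*} (M : CoxeterMatrix B) {i j : B} (h : i ≠ j)
    {k : ℕ} (hk : M i j = 0 ∨ k ≤ M i j) : 0 ≤ chebSeq (M.weight i j) k := by
  by_cases h0 : M i j = 0
  · simp [CoxeterMatrix.weight, h0, chebSeq_two]
  replace hk := hk.resolve_left h0
  have h1 := M.off_diagonal i j h
  have hm : (2 : ℝ) ≤ M i j := by exact_mod_cast (by omega : 2 ≤ M i j)
  have hpos : 0 < Real.pi / M i j := div_pos Real.pi_pos (by linarith)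
  have hle := M.angle_le_half_pi h
  have hsin : 0 < Real.sin (Real.pi / M i j) :=
    Real.sin_pos_of_pos_of_lt_pi hpos (by linarith [Real.pi_pos])
  have hk' : 0 ≤ Real.sin (k * (Real.pi / M i j)) := by
    apply Real.sin_nonneg_of_nonneg_of_le_pi (by positivity)
    have : (k : ℝ) ≤ M i j := by exact_mod_cast hk
    calc (k : ℝ) * (Real.pi / M i j) ≤ M i j * (Real.pi / M i j) := by gcongr
      _ = Real.pi := by field_simp
  rw [← chebSeq_mul_sin] at hk'
  exact nonneg_of_mul_nonneg_left hk' hsin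

namespace CoxeterSystem

variable {B W : Type*} [Group W] {M : CoxeterMatrix B} (cs : CoxeterSystem M W)
  [Fintype B] [DecidableEq B]

/-- The geometric representation, in the coordinates given by the simple roots. -/
noncomputable def geomRep : W →* Module.End ℝ (B → ℝ) :=
  cs.lift ⟨M.simpleEnd, M.isLiftable_simpleEnd⟩

lemma geomRep_simple (i : B) (x : B → ℝ) :
    cs.geomRep (cs.simple i) x = x + M.rootForm i x • Pi.single i 1 := by
  rw [geomRep, cs.lift_apply_simple M.isLiftable_simpleEnd, M.simpleEnd_apply]

lemma geomRep_simple_single_self (i : B) :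
    cs.geomRep (cs.simple i) (Pi.single i 1) = -Pi.single i 1 := by
  rw [geomRep_simple, M.rootForm_single, M.weight_self]; module

lemma geomRep_mul (v w : W) (x : B → ℝ) :
    cs.geomRep (v * w) x = cs.geomRep v (cs.geomRep w x) := by
  rw [map_mul, Module.End.mul_apply]

lemma geomRep_inv_geomRep (w : W) (x : B → ℝ) : cs.geomRep w⁻¹ (cs.geomRep w x) = x := by
  rw [← geomRep_mul]; simp

lemma geomRep_injective_apply (w : W) : Function.Injective (cs.geomRep w) :=
  Function.LeftInverse.injective (cs.geomRep_inv_geomRep w)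

lemma form_geomRep (w : W) (x y : B → ℝ) :
    M.form (cs.geomRep w x) (cs.geomRep w y) = M.form x y := by
  induction w using cs.simple_induction_left generalizing x y with
  | one => simp
  | mul_simple_left w i ih =>
    rw [geomRep_mul, geomRep_mul]
    simp only [geomRep_simple, ← M.simpleEnd_apply] at *
    rw [M.form_simpleEnd, ih]

omit [Fintype B] [DecidableEq B] in
lemma length_altProd_le (L : Bool → B) (b : Bool) (k : ℕ) :
    cs.length (altProd (fun c ↦ cs.simple (L c)) b k) ≤ k := by
  induction k with
  | zero => simp [altProd]
  | succ k ih =>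
    rw [altProd]
    refine (cs.length_mul_le _ _).trans ?_
    rw [cs.length_simple]; omega

omit [Fintype B] [DecidableEq B] in
lemma altProd_eq_wordProd (L : Bool → B) (b : Bool) (k : ℕ) :
    altProd (fun c ↦ cs.simple (L c)) b k = cs.wordProd (alternatingWord (L !b) (L b) k) := by
  induction k generalizing b with
  | zero => simp [altProd, alternatingWord]
  | succ k ih =>
    rw [altProd_succ', ih, alternatingWord_succ, wordProd_concat]
    simp

omit [Fintype B] [DecidableEq B] in
lemma altProd_braid (L : Bool → B) (b : Bool) :
    altProd (fun c ↦ cs.simple (L c)) b (M (L !b) (L b))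
      = altProd (fun c ↦ cs.simple (L c)) (!b) (M (L !b) (L b)) := by
  rw [altProd_eq_wordProd, altProd_eq_wordProd,
    cs.prod_alternatingWord_eq_prod_alternatingWord_sub _ _ _ (by omega)]
  simp only [Bool.not_not]
  congr 2
  omega

lemma geomRep_altProd_single (L : Bool → B) (b : Bool) (k : ℕ) :
    cs.geomRep (altProd (fun c ↦ cs.simple (L c)) b k) (Pi.single (L !b) 1)
      = chebSeq (M.weight (L !b) (L b)) (k + 1) • Pi.single (L (xor (!b) k.bodd)) 1
        + chebSeq (M.weight (L !b) (L b)) k • Pi.single (L (xor b k.bodd)) 1 := by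
  induction k with
  | zero => simp [altProd, chebSeq]
  | succ k ih =>
    have hw : M.weight (L (xor b k.bodd)) (L (xor (!b) k.bodd)) = M.weight (L !b) (L b) := by
      cases k.bodd <;> simp [M.weight_comm]
    rw [altProd, geomRep_mul, ih, geomRep_simple]
    simp only [map_add, map_smul, M.rootForm_single, M.weight_self, hw, smul_eq_mul, chebSeq,
      Nat.bodd_succ]
    rw [show (xor (!b) !k.bodd) = xor b k.bodd by cases b <;> cases k.bodd <;> rfl,
      show (xor b !k.bodd) = xor (!b) k.bodd by cases b <;> cases k.bodd <;> rfl]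
    module

lemma geomRep_single_nonneg (w : W) (i : B) (h : cs.length w < cs.length (w * cs.simple i)) :
    0 ≤ cs.geomRep w (Pi.single i 1) := by
  induction hn : cs.length w using Nat.strong_induction_on generalizing w i with
  | _ n IH =>
  subst hn
  by_cases hw : w = 1
  · subst hw; simp
  obtain ⟨j, hj⟩ := cs.exists_rightDescent_of_ne_one hw
  have hij : i ≠ j := by rintro rfl; exact absurd hj (by simp [IsRightDescent, h.le])
  let L : Bool → B := fun b ↦ bif b then j else i
  set g : ℕ → W := altProd (fun c ↦ cs.simple (L c)) true with hg
  have hgs (k : ℕ) : w * (g (k + 1))⁻¹ = w * (g k)⁻¹ * cs.simple (L (xor true k.bodd)) := by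
    simp [hg, altProd, mul_assoc]
  have hex : ∃ k, cs.length (w * (g k)⁻¹) + k ≠ cs.length w := ⟨cs.length w + 1, by omega⟩
  classical
  obtain ⟨n, hn, hmin⟩ : ∃ n, cs.length (w * (g n)⁻¹) + n ≠ cs.length w ∧
      ∀ k < n, cs.length (w * (g k)⁻¹) + k = cs.length w :=
    ⟨Nat.find hex, Nat.find_spec hex, fun k hk ↦ by simpa using Nat.find_min hex hk⟩
  have hn2 : 2 ≤ n := by
    by_contra! hlt
    interval_cases n
    · simp [hg, altProd] at hn
    · rw [hgs] at hn
      have h1 := (cs.isRightDescent_iff).1 hj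
      simp [hg, altProd, L] at hn
      omega
  obtain ⟨k, rfl⟩ : ∃ k, n = k + 2 := ⟨n - 2, by omega⟩
  set v := w * (g (k + 1))⁻¹ with hv
  have hvlen : cs.length v + (k + 1) = cs.length w := hmin (k + 1) (by omega)
  have hnext : cs.length v < cs.length (v * cs.simple (L (xor true (k + 1).bodd))) := by
    rw [show k + 2 = (k + 1) + 1 from rfl, hgs, ← hv] at hn
    rcases cs.length_mul_simple v (L (xor true (k + 1).bodd)) with h | h <;> omega
  have hprev : cs.length v < cs.length (v * cs.simple (L (xor true k.bodd))) := by
    have h0 := hmin k (by omega)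
    have hv' : v * cs.simple (L (xor true k.bodd)) = w * (g k)⁻¹ := by
      rw [hv, hgs, cs.simple_mul_simple_cancel_right]
    rw [hv']
    omega
  have hpos1 := IH _ (by omega) v _ hnext rfl
  have hpos2 := IH _ (by omega) v _ hprev rfl
  have hwv : w = v * g (k + 1) := by simp [hv]
  have hbound : M i j = 0 ∨ k + 2 ≤ M i j := by
    by_contra! hcon
    obtain ⟨hm0, hlt⟩ := hcon
    obtain ⟨m, hm⟩ := Nat.exists_eq_succ_of_ne_zero hm0
    have hbr := cs.altProd_braid L true
    change altProd _ true (M i j) = altProd _ false (M i j) at hbr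
    rw [hm, Nat.succ_eq_add_one, altProd_succ' _ false] at hbr
    have hQ := hmin (m + 1) (by omega)
    have hle := cs.length_mul_le (w * (g (m + 1))⁻¹)
      (altProd (fun c ↦ cs.simple (L c)) true m)
    have hle' := cs.length_altProd_le L true m
    have : w * cs.simple i = w * (g (m + 1))⁻¹ * altProd (fun c ↦ cs.simple (L c)) true m := by
      have : g (m + 1) = altProd (fun c ↦ cs.simple (L c)) true m * cs.simple i := hbr
      rw [this]; simp [mul_assoc]
    rw [← this] at hle
    omega
  have key := cs.geomRep_altProd_single L true (k + 1)
  rw [hwv, geomRep_mul]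
  change cs.geomRep (g (k + 1)) (Pi.single i 1) = _ at key
  rw [key, map_add, map_smul, map_smul]
  have e : (xor (!true) (k + 1).bodd) = xor true k.bodd := by
    rw [Nat.bodd_succ]; cases k.bodd <;> rfl
  rw [e]
  exact add_nonneg (smul_nonneg (M.chebSeq_weight_nonneg hij hbound) hpos2)
    (smul_nonneg (M.chebSeq_weight_nonneg hij (hbound.imp_right (by omega))) hpos1)

lemma geomRep_single_nonpos (w : W) (i : B) (h : cs.length (w * cs.simple i) < cs.length w) :
    cs.geomRep w (Pi.single i 1) ≤ 0 := by
  have := cs.geomRep_single_nonneg (w * cs.simple i) i (by simpa using h)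
  rw [geomRep_mul, geomRep_simple_single_self, map_neg] at this
  simpa using this

lemma geomRep_single_nonneg_or_nonpos (w : W) (i : B) :
    0 ≤ cs.geomRep w (Pi.single i 1) ∨ cs.geomRep w (Pi.single i 1) ≤ 0 := by
  rcases lt_or_gt_of_ne (cs.length_mul_simple_ne w i) with h | h
  · exact Or.inr (cs.geomRep_single_nonpos w i h)
  · exact Or.inl (cs.geomRep_single_nonneg w i h)

lemma geomRep_single_ne_zero (w : W) (i : B) : cs.geomRep w (Pi.single i 1) ≠ 0 := by
  intro h
  have := cs.geomRep_injective_apply w (h.trans (map_zero _).symm)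
  simpa using congrFun this i

lemma eq_one_of_geomRep_nonneg (w : W) (h : ∀ i, 0 ≤ cs.geomRep w (Pi.single i 1)) : w = 1 := by
  by_contra hw
  obtain ⟨i, hi⟩ := cs.exists_rightDescent_of_ne_one hw
  exact cs.geomRep_single_ne_zero w i (le_antisymm (cs.geomRep_single_nonpos w i hi) (h i))

lemma geomRep_injective : Function.Injective cs.geomRep := by
  rw [injective_iff_map_eq_one]
  intro w hw
  exact cs.eq_one_of_geomRep_nonneg w fun i ↦ by simp [hw]

end CoxeterSystem

namespace CoxeterSystem

variable {B W : Type*} [Group W] {M : CoxeterMatrix B} (cs : CoxeterSystem M W)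
  [Fintype B] [DecidableEq B]

lemma geomRep_conj (w : W) (i : B) (x : B → ℝ) :
    cs.geomRep (w * cs.simple i * w⁻¹) x
      = x + M.form (cs.geomRep w (Pi.single i 1)) x • cs.geomRep w (Pi.single i 1) := by
  have h : cs.geomRep w (cs.geomRep w⁻¹ x) = x := by simp
  rw [geomRep_mul, geomRep_mul, geomRep_simple, map_add, map_smul, h, ← M.form_single_left,
    ← cs.form_geomRep w, h]

lemma form_geomRep_single_self (w : W) (i : B) :
    M.form (cs.geomRep w (Pi.single i 1)) (cs.geomRep w (Pi.single i 1)) = -2 := by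
  rw [form_geomRep, M.form_single_left, M.rootForm_single, M.weight_self]

lemma conj_simple_eq_iff (v w : W) (i j : B) :
    w * cs.simple i * w⁻¹ = v * cs.simple j * v⁻¹ ↔
      cs.geomRep w (Pi.single i 1) = cs.geomRep v (Pi.single j 1) ∨
        cs.geomRep w (Pi.single i 1) = -cs.geomRep v (Pi.single j 1) := by
  constructor
  · intro h
    have h1 := congrArg (fun u ↦ cs.geomRep u (cs.geomRep w (Pi.single i 1))) h
    have hf := cs.form_geomRep_single_self w i
    have hg := cs.form_geomRep_single_self v j
    simp only [geomRep_conj, hf] at h1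
    set β := cs.geomRep w (Pi.single i 1)
    set γ := cs.geomRep v (Pi.single j 1)
    obtain ⟨r, hr⟩ : ∃ r : ℝ, β = r • γ := by
      refine ⟨-(M.form γ β) / 2, ?_⟩
      have h2 : (-2 : ℝ) • β = M.form γ β • γ := add_left_cancel h1
      rw [neg_div, neg_smul, div_eq_inv_mul, mul_smul, ← h2]
      module
    rw [hr, M.form_smul_left, M.form_comm, M.form_smul_left, hg] at hf
    have : (r - 1) * (r + 1) = 0 := by linarith
    rcases mul_eq_zero.1 this with h3 | h3
    · left; rw [hr, show r = 1 by linarith, one_smul]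
    · right; rw [hr, show r = -1 by linarith]; module
  · intro h
    apply cs.geomRep_injective
    refine LinearMap.ext fun x ↦ ?_
    rw [geomRep_conj, geomRep_conj]
    rcases h with h | h
    · rw [h]
    · rw [h, ← neg_one_smul ℝ, M.form_smul_left]; module

lemma conj_simple_eq_of_geomRep_eq {w : W} {i j : B}
    (h : cs.geomRep w (Pi.single i 1) = Pi.single j 1) :
    w * cs.simple i * w⁻¹ = cs.simple j := by
  have := (cs.conj_simple_eq_iff 1 w i j).2 (Or.inl (by simpa using h))
  simpa using this

lemma conj_simple_eq_of_geomRep_eq_neg {w : W} {i j : B}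
    (h : cs.geomRep w (Pi.single i 1) = -Pi.single j 1) :
    w * cs.simple i * w⁻¹ = cs.simple j := by
  have := (cs.conj_simple_eq_iff 1 w i j).2 (Or.inr (by simpa using h))
  simpa using this

lemma simple_injective_of_fintype : Function.Injective cs.simple := by
  intro i j h
  have h' := (cs.conj_simple_eq_iff 1 1 i j).1 (by simp [h])
  simp only [map_one, Module.End.one_apply] at h'
  by_contra hij
  rcases h' with h' | h' <;> simpa [Ne.symm hij, hij] using congrFun h' i

lemma weight_eq_zero_of_commute {i j : B} (hij : i ≠ j)
    (h : Commute (cs.simple i) (cs.simple j)) : M.weight i j = 0 := by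
  have h1 := congrArg (fun u ↦ cs.geomRep u (Pi.single j 1) i) h.eq
  simp [geomRep_simple, M.rootForm_single, M.weight_self, hij] at h1
  linarith

omit [Fintype B] [DecidableEq B] in
lemma commute_of_weight_eq_zero {i j : B} (h : M.weight i j = 0) :
    Commute (cs.simple i) (cs.simple j) := by
  have h1 := cs.simple_mul_simple_pow i j
  rw [M.eq_two_of_weight_eq_zero h, pow_two] at h1
  have h2 := eq_inv_of_mul_eq_one_left h1
  simpa [Commute, SemiconjBy] using h2

/-- A positive root supported on pairwise orthogonal simple roots is simple. -/
lemma exists_geomRep_single_eq_single {w : W} {i : B} (h0 : 0 ≤ cs.geomRep w (Pi.single i 1))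
    (P : B → Prop) (hP : ∀ j k, P j → P k → j ≠ k → M.weight j k = 0)
    (hsupp : ∀ j, ¬ P j → cs.geomRep w (Pi.single i 1) j = 0) :
    ∃ j, cs.geomRep w (Pi.single i 1) = Pi.single j 1 := by
  have hf := cs.form_geomRep_single_self w i
  obtain ⟨j, hj⟩ := Function.ne_iff.1 (cs.geomRep_single_ne_zero w i)
  have hsgn := cs.geomRep_single_nonneg_or_nonpos (cs.simple j * w) i
  rw [geomRep_mul, geomRep_simple] at hsgn
  set β := cs.geomRep w (Pi.single i 1)
  have hPj : P j := by
    by_contra h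
    exact hj (hsupp j h)
  have hform : M.rootForm j β = -2 * β j := by
    rw [M.rootForm_apply, Finset.sum_eq_single j, M.weight_self]
    · intro k _ hk
      by_cases hPk : P k
      · rw [hP j k hPj hPk hk.symm, zero_mul]
      · rw [hsupp k hPk, mul_zero]
    · simp
  have hpos : 0 < β j := lt_of_le_of_ne (h0 j) (Ne.symm hj)
  have hneg : β + M.rootForm j β • Pi.single j 1 ≤ 0 := by
    refine hsgn.resolve_left fun h ↦ ?_
    have := h j
    simp [hform] at this
    linarith
  have hzero (k : B) (hk : k ≠ j) : β k = 0 := by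
    have := hneg k
    simp [hk] at this
    exact le_antisymm this (h0 k)
  have hβ : β = β j • Pi.single j 1 := by
    ext k
    by_cases hk : k = j
    · subst hk; simp
    · simp [hk, hzero k hk]
  refine ⟨j, ?_⟩
  rw [hβ, M.form_smul_left, M.form_comm, M.form_smul_left, M.form_single_left,
    M.rootForm_single, M.weight_self] at hf
  have : (β j - 1) * (β j + 1) = 0 := by linarith
  rcases mul_eq_zero.1 this with h | h
  · rw [hβ, show β j = 1 by linarith, one_smul]
  · linarith

end CoxeterSystem

/-- **Perron's theorem** for an irreducible symmetric matrix, nonnegative off the diagonal. -/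
lemma exists_pos_eigenvector {B : Type*} [Fintype B] [Nonempty B] (A : B → B → ℝ)
    (hsymm : ∀ i j, A i j = A j i) (hnn : ∀ i j, i ≠ j → 0 ≤ A i j)
    (hirr : ∀ J : Set B, J.Nonempty → Jᶜ.Nonempty → ∃ i ∈ J, ∃ j ∈ Jᶜ, A i j ≠ 0) :
    ∃ (v : B → ℝ) (μ : ℝ), (∀ i, 0 < v i) ∧ ∀ i, ∑ j, A i j * v j = μ * v i := by
  classical
  let q : (B → ℝ) → ℝ := fun x ↦ ∑ i, ∑ j, A i j * x i * x j
  let N : (B → ℝ) → ℝ := fun x ↦ ∑ i, x i ^ 2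
  have hqc : Continuous q := by fun_prop
  have hNc : Continuous N := by fun_prop
  have hcpt : IsCompact {x | N x = 1} := by
    refine Metric.isCompact_of_isClosed_isBounded (isClosed_eq hNc continuous_const) ?_
    refine (Metric.isBounded_closedBall (x := (0 : B → ℝ)) (r := 1)).subset fun x hx ↦ ?_
    rw [mem_closedBall_zero_iff, pi_norm_le_iff_of_nonneg zero_le_one]
    intro i
    have : x i ^ 2 ≤ 1 := by
      rw [← show N x = 1 from hx]
      exact Finset.single_le_sum (f := fun i ↦ x i ^ 2) (fun _ _ ↦ sq_nonneg _)
        (Finset.mem_univ i)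
    rw [Real.norm_eq_abs, abs_le_one_iff_mul_self_le_one]
    linarith
  have hne : {x | N x = 1}.Nonempty := by
    obtain ⟨i⟩ := ‹Nonempty B›
    exact ⟨Pi.single i 1, by simp [N, Pi.single_apply]⟩
  obtain ⟨x, hx, hmax⟩ := hcpt.exists_isMaxOn hne hqc.continuousOn
  set y : B → ℝ := fun i ↦ |x i| with hy
  have hNy : N y = 1 := by simpa [N, y] using hx
  have hy0 (i : B) : 0 ≤ y i := abs_nonneg _
  have hqy : q x ≤ q y := by
    refine Finset.sum_le_sum fun i _ ↦ Finset.sum_le_sum fun j _ ↦ ?_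
    by_cases hij : i = j
    · subst hij; simp [y, mul_assoc]
    · rw [mul_assoc, mul_assoc, hy, ← abs_mul]
      exact mul_le_mul_of_nonneg_left (le_abs_self _) (hnn i j hij)
  set μ := q y with hμ
  have hbound (z : B → ℝ) : q z ≤ μ * N z := by
    have hNz : 0 ≤ N z := Finset.sum_nonneg fun _ _ ↦ sq_nonneg _
    rcases hNz.eq_or_lt with h | h
    · have hz : z = 0 := by
        ext i
        have := (Finset.sum_eq_zero_iff_of_nonneg (fun _ _ ↦ sq_nonneg _)).1 h.symm i
          (Finset.mem_univ i)
        simpa using this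
      subst hz; simp [q, N]
    · have hs : Real.sqrt (N z) ≠ 0 := (Real.sqrt_pos.2 h).ne'
      have hs2 : Real.sqrt (N z) ^ 2 = N z := Real.sq_sqrt hNz
      have h1 : N ((Real.sqrt (N z))⁻¹ • z) = 1 := by
        simp only [N, Pi.smul_apply, smul_eq_mul, mul_pow, ← Finset.mul_sum]
        change _ * N z = 1
        rw [inv_pow, hs2, inv_mul_cancel₀ h.ne']
      have hinv : (Real.sqrt (N z))⁻¹ ^ 2 = (N z)⁻¹ := by rw [inv_pow, hs2]
      have h2 : q ((Real.sqrt (N z))⁻¹ • z) = (N z)⁻¹ * q z := by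
        simp only [q, Pi.smul_apply, smul_eq_mul, Finset.mul_sum]
        refine Finset.sum_congr rfl fun i _ ↦ Finset.sum_congr rfl fun j _ ↦ ?_
        linear_combination (A i j * z i * z j) * hinv
      have h3 : q ((Real.sqrt (N z))⁻¹ • z) ≤ q x := hmax h1
      rw [h2] at h3
      have h4 : (N z)⁻¹ * q z ≤ μ := h3.trans hqy
      rwa [inv_mul_le_iff₀ h, mul_comm] at h4
  have heig (i : B) : ∑ j, A i j * y j = μ * y i := by
    set d := ∑ j, A i j * y j with hd
    let z (r : ℝ) : B → ℝ := fun j ↦ y j + if j = i then r else 0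
    have hexp (r : ℝ) : q (z r) = q y + 2 * r * d + r ^ 2 * A i i := by
      have hd' : ∑ j, A j i * y j = d := by simp only [hd, hsymm]
      have : q (z r) = q y + r * (∑ j, A i j * y j) + r * (∑ j, A j i * y j)
          + r ^ 2 * A i i := by
        have e (j k : B) : A j k * (z r) j * (z r) k
            = A j k * y j * y k + (if j = i then r * (A i k * y k) else 0)
              + (if k = i then r * (A j i * y j) else 0)
              + (if j = i then (if k = i then r ^ 2 * A i i else 0) else 0) := by
          by_cases hj : j = i <;> by_cases hk : k = i <;> simp [z, hj, hk] <;> ring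
        simp only [q, e, Finset.sum_add_distrib, Finset.mul_sum]
        congr 1
        · congr 1
          · congr 1
            rw [Finset.sum_comm]; simp
          · simp
        · simp
      rw [this, hd', ← hd]; ring
    have hNexp (r : ℝ) : N (z r) = N y + 2 * r * y i + r ^ 2 := by
      have e (j : B) : (z r) j ^ 2
          = y j ^ 2 + (if j = i then 2 * r * y i + r ^ 2 else 0) := by
        by_cases hj : j = i
        · subst hj; simp [z]; ring
        · simp [z, hj]
      simp only [N, e, Finset.sum_add_distrib]
      simp; ring
    have hquad (r : ℝ) : 0 ≤ 2 * r * (μ * y i - d) + r ^ 2 * (μ - A i i) := by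
      have := hbound (z r)
      rw [hexp, hNexp, hNy] at this
      nlinarith
    set D := μ * y i - d with hD
    set K := |μ - A i i| + 1 with hK
    have hKpos : 0 < K := by positivity
    have hKle : μ - A i i ≤ K := by linarith [le_abs_self (μ - A i i)]
    have h1 := hquad (-(D / K))
    have h2 : (-(D / K)) ^ 2 * (μ - A i i) ≤ (D / K) ^ 2 * K := by
      rw [neg_sq]; exact mul_le_mul_of_nonneg_left hKle (sq_nonneg _)
    have h3 : 2 * (-(D / K)) * D + (D / K) ^ 2 * K = -(D ^ 2 / K) := by field_simp; ring
    have h4 : D ^ 2 / K ≤ 0 := by linarith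
    have h5 : D ^ 2 ≤ 0 := by
      rwa [div_le_iff₀ hKpos, zero_mul] at h4
    have h6 : D = 0 := pow_eq_zero_iff (two_ne_zero) |>.1 (le_antisymm h5 (sq_nonneg _))
    linarith
  refine ⟨y, μ, fun i ↦ ?_, heig⟩
  by_contra hi
  have hi0 : y i = 0 := le_antisymm (not_lt.1 hi) (hy0 i)
  have hcompl : ({j | y j = 0}ᶜ : Set B).Nonempty := by
    by_contra hempty
    rw [Set.not_nonempty_iff_eq_empty, Set.compl_empty_iff] at hempty
    have : N y = 0 := Finset.sum_eq_zero fun j _ ↦ by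
      have : j ∈ {j | y j = 0} := hempty ▸ Set.mem_univ j
      rw [show y j = 0 from this]; norm_num
    rw [hNy] at this
    norm_num at this
  obtain ⟨j, hj, k, hk, hjk⟩ := hirr {j | y j = 0} ⟨i, hi0⟩ hcompl
  have hj0 : y j = 0 := hj
  have hsum := heig j
  rw [hj0, mul_zero, Finset.sum_eq_zero_iff_of_nonneg] at hsum
  · exact (mul_ne_zero hjk hk) (hsum k (Finset.mem_univ k))
  · intro l _
    by_cases hl : l = j
    · simp [hl, hj0]
    · exact mul_nonneg (hnn j l (Ne.symm hl)) (hy0 l)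

section chebSeq

lemma chebSeq_invariant (μ : ℝ) (k : ℕ) :
    chebSeq μ k ^ 2 + chebSeq μ (k + 1) ^ 2 - μ * (chebSeq μ k * chebSeq μ (k + 1)) = 1 := by
  induction k with
  | zero => simp [chebSeq]
  | succ k ih => rw [chebSeq]; linear_combination ih

/-- If consecutive terms of `chebSeq μ` never have opposite signs and some term vanishes, then the
terms before the first zero are positive, the last of them is `1`, and the sequence then changes
sign. -/
lemma exists_chebSeq_zero {μ : ℝ} (hs : ∀ k, 0 ≤ chebSeq μ k * chebSeq μ (k + 1))
    {N : ℕ} (hN : 0 < N) (h0 : chebSeq μ N = 0) :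
    ∃ n, 0 < n ∧ (∀ k, 0 < k → k ≤ n → 0 < chebSeq μ k) ∧
      ∀ k, chebSeq μ (n + 1 + k) = -chebSeq μ k := by
  classical
  have hex : ∃ k, 0 < k ∧ chebSeq μ k = 0 := ⟨N, hN, h0⟩
  obtain ⟨hm, hz⟩ := Nat.find_spec hex
  have hmin : ∀ k, 0 < k → k < Nat.find hex → chebSeq μ k ≠ 0 := fun k hk hlt h ↦
    Nat.find_min hex hlt ⟨hk, h⟩
  obtain ⟨n, hn⟩ : ∃ n, Nat.find hex = n + 1 := ⟨Nat.find hex - 1, by omega⟩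
  rw [hn] at hz hmin
  have hn0 : n ≠ 0 := by rintro rfl; simp [chebSeq] at hz
  have hpos : ∀ k, k < n → 0 < chebSeq μ (k + 1) := by
    intro k hk
    induction k with
    | zero => simp [chebSeq]
    | succ k ih =>
      have h1 := ih (by omega)
      have h2 := hs (k + 1)
      have h3 := hmin (k + 2) (by omega) (by omega)
      rcases lt_or_gt_of_ne h3 with h | h
      · nlinarith
      · exact h
  have hpos' : ∀ k, 0 < k → k ≤ n → 0 < chebSeq μ k := fun k h1 h2 ↦ by
    obtain ⟨k, rfl⟩ := Nat.exists_eq_succ_of_ne_zero h1.ne'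
    exact hpos k (by omega)
  have hone : chebSeq μ n = 1 := by
    have h1 := chebSeq_invariant μ n
    have h2 := hpos' n (by omega) le_rfl
    rw [hz] at h1
    nlinarith
  refine ⟨n, by omega, hpos', fun k ↦ ?_⟩
  induction k using Nat.twoStepInduction with
  | zero => simp [hz, chebSeq]
  | one =>
    change μ * chebSeq μ (n + 1) - chebSeq μ n = -1
    rw [hz, hone]; ring
  | more k h1 h2 =>
    change μ * chebSeq μ (n + 1 + (k + 1)) - chebSeq μ (n + 1 + k)
      = -(μ * chebSeq μ (k + 1) - chebSeq μ k)
    rw [h1, h2]; ring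

end chebSeq

/-- A two-colouring of the simple reflections with commuting colour classes, the products `factor b`
of the colour classes, and a positive eigenvector of the Cartan matrix. -/
structure BipartiteFrame {B W : Type*} [Group W] {M : CoxeterMatrix B} (cs : CoxeterSystem M W)
    [Fintype B] [DecidableEq B] where
  color : B → Bool
  factor : Bool → W
  weight_eq_zero : ∀ i j, color i = color j → i ≠ j → M.weight i j = 0
  factor_mul_self : ∀ b, factor b * factor b = 1
  geomRep_factor : ∀ b x i, cs.geomRep (factor b) x i
    = if color i = b then x i + M.rootForm i x else x i
  vec : B → ℝ
  vec_pos : ∀ i, 0 < vec i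
  eig : ℝ
  eigen : ∀ i, ∑ j, M.weight i j * vec j = (eig - 2) * vec i

namespace BipartiteFrame

variable {B W : Type*} [Group W] {M : CoxeterMatrix B} {cs : CoxeterSystem M W}
  [Fintype B] [DecidableEq B] (F : BipartiteFrame cs)

/-- Pairing with the part of the positive eigenvector supported on colour `b`. -/
noncomputable def proj (b : Bool) (x : B → ℝ) : ℝ :=
  ∑ i, if F.color i = b then F.vec i * x i else 0

lemma proj_single (b : Bool) (i : B) :
    F.proj b (Pi.single i 1) = if F.color i = b then F.vec i else 0 := by
  rw [proj, Finset.sum_eq_single i]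
  · simp
  · intro j _ hj; simp [hj]
  · simp

lemma proj_neg (b : Bool) (x : B → ℝ) : F.proj b (-x) = -F.proj b x := by
  rw [proj, proj, ← Finset.sum_neg_distrib]
  exact Finset.sum_congr rfl fun i _ ↦ by split_ifs <;> simp

lemma proj_nonneg (b : Bool) {x : B → ℝ} (hx : 0 ≤ x) : 0 ≤ F.proj b x :=
  Finset.sum_nonneg fun i _ ↦ by
    split_ifs
    exacts [mul_nonneg (F.vec_pos i).le (hx i), le_rfl]

lemma proj_nonpos (b : Bool) {x : B → ℝ} (hx : x ≤ 0) : F.proj b x ≤ 0 := by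
  have := F.proj_nonneg b (neg_nonneg.2 hx)
  rw [proj_neg] at this
  linarith

lemma eq_zero_of_proj_eq_zero {b : Bool} {x : B → ℝ} (hx : 0 ≤ x) (h : F.proj b x = 0) {i : B}
    (hi : F.color i = b) : x i = 0 := by
  have h1 := (Finset.sum_eq_zero_iff_of_nonneg (fun i _ ↦ by
    split_ifs
    exacts [mul_nonneg (F.vec_pos i).le (hx i), le_rfl])).1 h i (Finset.mem_univ i)
  rw [if_pos hi] at h1
  exact (mul_eq_zero.1 h1).resolve_left (F.vec_pos i).ne'

lemma proj_not_factor (b : Bool) (x : B → ℝ) :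
    F.proj (!b) (cs.geomRep (F.factor b) x) = F.proj (!b) x := by
  refine Finset.sum_congr rfl fun i _ ↦ ?_
  by_cases h : F.color i = !b
  · rw [if_pos h, if_pos h, F.geomRep_factor, if_neg (by simp [h])]
  · rw [if_neg h, if_neg h]

lemma sum_vec_mul_weight (b : Bool) (j : B) :
    ∑ i, (if F.color i = b then F.vec i * M.weight i j else 0)
      = if F.color j = b then -2 * F.vec j else F.eig * F.vec j := by
  split_ifs with h
  · rw [Finset.sum_eq_single j]
    · rw [if_pos h, M.weight_self]; ring
    · intro i _ hi
      split_ifs with h'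
      · rw [F.weight_eq_zero i j (h'.trans h.symm) hi, mul_zero]
      · rfl
    · simp
  · have h1 : ∀ i, (if F.color i = b then F.vec i * M.weight i j else 0)
        = M.weight j i * F.vec i + (if i = j then 2 * F.vec j else 0) := by
      intro i
      by_cases hij : i = j
      · subst hij
        rw [if_neg h, if_pos rfl, M.weight_self]; ring
      · rw [if_neg hij]
        split_ifs with h'
        · rw [M.weight_comm]; ring
        · rw [F.weight_eq_zero j i _ (Ne.symm hij)]
          · ring
          · revert h h'; cases F.color i <;> cases F.color j <;> cases b <;> simp
    rw [Finset.sum_congr rfl fun i _ ↦ h1 i, Finset.sum_add_distrib, F.eigen]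
    simp; ring

lemma proj_factor (b : Bool) (x : B → ℝ) :
    F.proj b (cs.geomRep (F.factor b) x) = F.eig * F.proj (!b) x - F.proj b x := by
  have h1 : F.proj b (cs.geomRep (F.factor b) x)
      = F.proj b x + ∑ i, ∑ j, (if F.color i = b then F.vec i * M.weight i j else 0) * x j := by
    rw [proj, proj, ← Finset.sum_add_distrib]
    refine Finset.sum_congr rfl fun i _ ↦ ?_
    rw [F.geomRep_factor, M.rootForm_apply]
    split_ifs with h
    · rw [mul_add, Finset.mul_sum]
      exact congrArg _ (Finset.sum_congr rfl fun j _ ↦ by ring)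
    · simp
  rw [h1, Finset.sum_comm]
  simp_rw [← Finset.sum_mul, sum_vec_mul_weight]
  rw [proj, proj, Finset.mul_sum, ← Finset.sum_add_distrib, ← Finset.sum_sub_distrib]
  refine Finset.sum_congr rfl fun i _ ↦ ?_
  cases F.color i <;> cases b <;> simp <;> ring

lemma factor_inv (b : Bool) : (F.factor b)⁻¹ = F.factor b :=
  inv_eq_of_mul_eq_one_right (F.factor_mul_self b)

lemma geomRep_factor_factor (b : Bool) (x : B → ℝ) :
    cs.geomRep (F.factor b) (cs.geomRep (F.factor b) x) = x := by
  rw [← cs.geomRep_mul, F.factor_mul_self]; simp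

lemma geomRep_factor_single (i : B) :
    cs.geomRep (F.factor (F.color i)) (Pi.single i 1) = -Pi.single i 1 := by
  ext j
  rw [F.geomRep_factor, M.rootForm_single]
  by_cases hij : j = i
  · subst hij
    simp [M.weight_self]; norm_num
  · split_ifs with h
    · simp [hij, F.weight_eq_zero j i h hij]
    · simp [hij]

/-- The roots obtained from a simple root `i` by alternately applying the two factors, beginning
with the one that does not contain `i`. -/
noncomputable def walkRoot (i : B) (k : ℕ) : B → ℝ :=
  cs.geomRep (altProd F.factor (!F.color i) k) (Pi.single i 1)

lemma walkRoot_zero (i : B) : F.walkRoot i 0 = Pi.single i 1 := by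
  simp [walkRoot, altProd]

lemma walkRoot_succ (i : B) (k : ℕ) :
    F.walkRoot i (k + 1) = cs.geomRep (F.factor (!(F.color i ^^ k.bodd))) (F.walkRoot i k) := by
  rw [walkRoot, altProd, cs.geomRep_mul, walkRoot]
  congr 3
  cases F.color i <;> cases k.bodd <;> rfl

lemma proj_walkRoot (i : B) (k : ℕ) :
    F.proj (F.color i ^^ k.bodd) (F.walkRoot i k) = F.vec i * chebSeq F.eig (k + 1) ∧
    F.proj (!(F.color i ^^ k.bodd)) (F.walkRoot i k) = F.vec i * chebSeq F.eig k := by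
  induction k with
  | zero => simp [walkRoot_zero, proj_single, chebSeq]
  | succ k ih =>
    rw [walkRoot_succ, Nat.bodd_succ,
      show (F.color i ^^ !k.bodd) = !(F.color i ^^ k.bodd) by
        cases F.color i <;> cases k.bodd <;> rfl]
    constructor
    · rw [proj_factor, ih.2, Bool.not_not, ih.1, chebSeq]; ring
    · rw [proj_not_factor, Bool.not_not, ih.1]

lemma chebSeq_mul_nonneg (i : B) (k : ℕ) :
    0 ≤ chebSeq F.eig k * chebSeq F.eig (k + 1) := by
  obtain ⟨h1, h2⟩ := F.proj_walkRoot i k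
  have hv := F.vec_pos i
  rcases cs.geomRep_single_nonneg_or_nonpos (altProd F.factor (!F.color i) k) i with h | h
  · have h3 := F.proj_nonneg (F.color i ^^ k.bodd) h
    have h4 := F.proj_nonneg (!(F.color i ^^ k.bodd)) h
    change 0 ≤ F.proj _ (F.walkRoot i k) at h3 h4
    rw [h1] at h3; rw [h2] at h4
    exact mul_nonneg (nonneg_of_mul_nonneg_right h4 hv) (nonneg_of_mul_nonneg_right h3 hv)
  · have h3 := F.proj_nonpos (F.color i ^^ k.bodd) h
    have h4 := F.proj_nonpos (!(F.color i ^^ k.bodd)) h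
    change F.proj _ (F.walkRoot i k) ≤ 0 at h3 h4
    rw [h1] at h3; rw [h2] at h4
    exact mul_nonneg_of_nonpos_of_nonpos (nonpos_of_mul_nonpos_right h4 hv)
      (nonpos_of_mul_nonpos_right h3 hv)

lemma walkRoot_two_mul (i : B) (N : ℕ) :
    F.walkRoot i (2 * N)
      = cs.geomRep ((F.factor (F.color i) * F.factor (!F.color i)) ^ N) (Pi.single i 1) := by
  rw [walkRoot, altProd_two_mul, Bool.not_not]

/-- The number `n` is one less than the Coxeter number. -/
def IsPeriod (n : ℕ) : Prop :=
  0 < n ∧ (∀ k, 0 < k → k ≤ n → 0 < chebSeq F.eig k) ∧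
    ∀ k, chebSeq F.eig (n + 1 + k) = -chebSeq F.eig k

lemma exists_isPeriod [Finite W] (i : B) : ∃ n, F.IsPeriod n := by
  set g := F.factor (F.color i) * F.factor (!F.color i)
  have hg : 0 < orderOf g := orderOf_pos g
  refine exists_chebSeq_zero (F.chebSeq_mul_nonneg i) (N := 2 * orderOf g) (by omega) ?_
  have h1 := (F.proj_walkRoot i (2 * orderOf g)).2
  rw [walkRoot_two_mul, pow_orderOf_eq_one] at h1
  simp [proj_single] at h1
  rcases h1 with h | h
  · exact absurd h (F.vec_pos i).ne'
  · exact h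

end BipartiteFrame

lemma altProd_add {G : Type*} [Monoid G] (L : Bool → G) (b : Bool) (j k : ℕ) :
    altProd L b (j + k) = altProd L (b ^^ k.bodd) j * altProd L b k := by
  induction j with
  | zero => simp [altProd]
  | succ j ih =>
    rw [show j + 1 + k = j + k + 1 by ring, altProd, altProd, ih, mul_assoc, Nat.bodd_add]
    congr 2
    cases b <;> cases j.bodd <;> cases k.bodd <;> rfl

namespace BipartiteFrame

variable {B W : Type*} [Group W] {M : CoxeterMatrix B} {cs : CoxeterSystem M W}
  [Fintype B] [DecidableEq B] (F : BipartiteFrame cs) {n : ℕ} {i i' : B}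

variable {F}

lemma IsPeriod.chebSeq_eq_zero (hn : F.IsPeriod n) : chebSeq F.eig (n + 1) = 0 := by
  simpa [chebSeq] using hn.2.2 0

lemma IsPeriod.walkRoot_nonneg (hn : F.IsPeriod n) (i : B) {k : ℕ} (hk : k ≤ n) :
    0 ≤ F.walkRoot i k := by
  rcases k.eq_zero_or_pos with rfl | hk0
  · rw [walkRoot_zero]; exact Pi.single_nonneg.2 zero_le_one
  · refine (cs.geomRep_single_nonneg_or_nonpos _ i).resolve_right fun h ↦ ?_
    have h1 := F.proj_nonpos (!(F.color i ^^ k.bodd)) h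
    change F.proj _ (F.walkRoot i k) ≤ 0 at h1
    rw [(F.proj_walkRoot i k).2] at h1
    exact absurd h1 (not_le.2 (mul_pos (F.vec_pos i) (hn.2.1 k hk0 hk)))

variable (F) in
/-- A nonnegative root whose projection to one colour vanishes is simple. -/
lemma exists_eq_single_of_proj_eq_zero {w : W} (h0 : 0 ≤ cs.geomRep w (Pi.single i 1)) {b : Bool}
    (hb : F.proj b (cs.geomRep w (Pi.single i 1)) = 0) :
    ∃ j, cs.geomRep w (Pi.single i 1) = Pi.single j 1 := by
  refine cs.exists_geomRep_single_eq_single h0 (fun j ↦ F.color j = !b)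
    (fun j k hj hk ↦ F.weight_eq_zero j k (hj.trans hk.symm)) fun j hj ↦ ?_
  exact F.eq_zero_of_proj_eq_zero h0 hb (by simpa using hj)

lemma IsPeriod.exists_partner (hn : F.IsPeriod n) (i : B) :
    ∃ i', F.walkRoot i n = Pi.single i' 1 := by
  refine F.exists_eq_single_of_proj_eq_zero (hn.walkRoot_nonneg i le_rfl)
    (b := F.color i ^^ n.bodd) ?_
  have := (F.proj_walkRoot i n).1
  rw [hn.chebSeq_eq_zero, mul_zero] at this
  exact this

lemma IsPeriod.color_partner (hn : F.IsPeriod n) (hi : F.walkRoot i n = Pi.single i' 1) :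
    F.color i' = !(F.color i ^^ n.bodd) := by
  have := (F.proj_walkRoot i n).1
  rw [hn.chebSeq_eq_zero, mul_zero, hi, proj_single] at this
  by_contra h
  rw [if_pos (by simpa using h)] at this
  exact (F.vec_pos i').ne' this

lemma IsPeriod.walkRoot_succ_period (hn : F.IsPeriod n) (hi : F.walkRoot i n = Pi.single i' 1) :
    F.walkRoot i (n + 1) = -Pi.single i' 1 := by
  rw [walkRoot_succ, hi, ← hn.color_partner hi, geomRep_factor_single]

lemma IsPeriod.walkRoot_reverse (hn : F.IsPeriod n) (hi : F.walkRoot i n = Pi.single i' 1)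
    {k j : ℕ} (h : k + j = n) : F.walkRoot i' k = F.walkRoot i j := by
  induction k generalizing j with
  | zero => rw [walkRoot_zero, ← hi, ← h, zero_add]
  | succ k ih =>
    have hc : (F.color i' ^^ k.bodd) = (F.color i ^^ j.bodd) := by
      rw [hn.color_partner hi, ← h, Nat.bodd_add, Nat.bodd_succ]
      cases F.color i <;> cases k.bodd <;> cases j.bodd <;> rfl
    rw [walkRoot_succ, ih (j := j + 1) (by omega), walkRoot_succ, hc, geomRep_factor_factor]

lemma IsPeriod.partner_symm (hn : F.IsPeriod n) (hi : F.walkRoot i n = Pi.single i' 1) :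
    F.walkRoot i' n = Pi.single i 1 := by
  rw [hn.walkRoot_reverse hi (add_zero n), walkRoot_zero]

lemma IsPeriod.geomRep_altProd (hn : F.IsPeriod n) (hi : F.walkRoot i n = Pi.single i' 1)
    (b : Bool) : cs.geomRep (altProd F.factor b (n + 1)) (Pi.single i 1) = -Pi.single i' 1 := by
  by_cases hb : b = F.color i
  · rw [altProd_succ', cs.geomRep_mul, hb, geomRep_factor_single, map_neg]
    exact congrArg _ hi
  · rw [show b = !F.color i by revert hb; cases b <;> cases F.color i <;> simp]
    exact hn.walkRoot_succ_period hi

lemma IsPeriod.geomRep_altProd_nonpos (hn : F.IsPeriod n) (b : Bool) {x : B → ℝ} (hx : 0 ≤ x) :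
    cs.geomRep (altProd F.factor b (n + 1)) x ≤ 0 := by
  rw [← Finset.univ_sum_single x, map_sum]
  refine Finset.sum_nonpos fun i _ ↦ ?_
  obtain ⟨i', hi⟩ := hn.exists_partner i
  rw [show Pi.single i (x i) = x i • (Pi.single i 1 : B → ℝ) by
    rw [← Pi.single_smul]; simp, map_smul, hn.geomRep_altProd hi, smul_neg, neg_nonpos]
  exact smul_nonneg (hx i) (Pi.single_nonneg.2 zero_le_one)

lemma IsPeriod.altProd_two_mul_eq_one (hn : F.IsPeriod n) (b : Bool) :
    altProd F.factor b (2 * (n + 1)) = 1 := by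
  refine cs.eq_one_of_geomRep_nonneg _ fun i ↦ ?_
  obtain ⟨i', hi⟩ := hn.exists_partner i
  rw [two_mul, altProd_add, cs.geomRep_mul, hn.geomRep_altProd hi, map_neg,
    hn.geomRep_altProd (hn.partner_symm hi), neg_neg]
  exact Pi.single_nonneg.2 zero_le_one

lemma IsPeriod.orderOf_eq [Nonempty B] (hn : F.IsPeriod n) :
    orderOf (F.factor false * F.factor true) = n + 1 := by
  have key : ∀ b, (F.factor (!b) * F.factor b) ^ (n + 1) = 1 := fun b ↦ by
    rw [← altProd_two_mul, hn.altProd_two_mul_eq_one]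
  obtain ⟨i⟩ := ‹Nonempty B›
  have h1 : ∀ m, 0 < m → m < n + 1 →
      (F.factor (F.color i) * F.factor (!F.color i)) ^ m ≠ 1 := by
    intro m hm0 hm h
    have h2 := F.walkRoot_two_mul i m
    rw [h] at h2
    have h3 := (F.proj_walkRoot i (2 * m)).2
    have h4 := (F.proj_walkRoot i (2 * m)).1
    have hv := (F.vec_pos i).ne'
    simp [h2, proj_single, hv] at h3 h4
    have h5 := hn.2.2 (2 * m - (n + 1))
    rcases lt_trichotomy (2 * m) (n + 1) with h6 | h6 | h6
    · exact (hn.2.1 (2 * m) (by omega) (by omega)).ne' h3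
    · have := hn.2.2 1
      rw [← h6, h4] at this
      simp [chebSeq] at this
      norm_num at this
    · rw [show n + 1 + (2 * m - (n + 1)) = 2 * m by omega, h3] at h5
      have := hn.2.1 (2 * m - (n + 1)) (by omega) (by omega)
      linarith
  have h2 : orderOf (F.factor (F.color i) * F.factor (!F.color i)) = n + 1 := by
    rw [orderOf_eq_iff (by omega)]
    exact ⟨by simpa using key (!F.color i), fun m hm hm0 ↦ h1 m hm0 hm⟩
  cases hc : F.color i
  · simpa [hc] using h2
  · rw [← h2, hc, Bool.not_true]
    exact SemiconjBy.orderOf_eq (F.factor true) (mul_assoc _ _ _).symm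

lemma IsPeriod.longest_eq (hn : F.IsPeriod n) {w₀ : W} (h : ∀ u, cs.length u ≤ cs.length w₀)
    (b : Bool) : w₀ = altProd F.factor b (n + 1) := by
  have key : ∀ w : W, (∀ u, cs.length u ≤ cs.length w) → altProd F.factor b (n + 1) * w = 1 := by
    intro w hw
    refine cs.eq_one_of_geomRep_nonneg _ fun i ↦ ?_
    have h1 := cs.geomRep_single_nonpos w i
      (lt_of_le_of_ne (hw _) (cs.length_mul_simple_ne w i))
    rw [cs.geomRep_mul, ← neg_nonpos, ← map_neg]
    exact hn.geomRep_altProd_nonpos b (neg_nonneg.2 h1)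
  have h2 := key w₀⁻¹ (by simpa [cs.length_inv] using h)
  exact (mul_inv_eq_one.1 h2).symm

lemma IsPeriod.longest_conj (hn : F.IsPeriod n) {w₀ : W} (h : ∀ u, cs.length u ≤ cs.length w₀)
    (hi : F.walkRoot i n = Pi.single i' 1) :
    w₀ * cs.simple i * w₀⁻¹ = cs.simple i' := by
  rw [hn.longest_eq h true]
  exact cs.conj_simple_eq_of_geomRep_eq_neg (hn.geomRep_altProd hi true)

end BipartiteFrame

lemma chebSeq_eq_of_eq {μ : ℝ} {j k : ℕ} (h0 : chebSeq μ j = chebSeq μ (k + j))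
    (h1 : chebSeq μ (j + 1) = chebSeq μ (k + j + 1)) : chebSeq μ k = 0 := by
  induction j with
  | zero => exact h0.symm
  | succ j ih =>
    refine ih ?_ h0
    rw [← add_assoc] at h0 h1
    rw [chebSeq, chebSeq] at h1
    linear_combination -h1 + μ * h0

lemma chebSeq_eq_of_eq_reverse {μ : ℝ} {j k : ℕ} (h0 : chebSeq μ j = chebSeq μ (k + 1))
    (h1 : chebSeq μ (j + 1) = chebSeq μ k) : chebSeq μ (j + k + 1) = 0 := by
  induction j generalizing k with
  | zero => simpa [chebSeq] using h0.symm
  | succ j ih =>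
    rw [show j + 1 + k + 1 = j + (k + 1) + 1 by ring]
    refine ih ?_ h0
    rw [chebSeq] at h1 ⊢
    linear_combination -h1 + μ * h0

namespace BipartiteFrame

variable {B W : Type*} [Group W] {M : CoxeterMatrix B} {cs : CoxeterSystem M W}
  [Fintype B] [DecidableEq B] (F : BipartiteFrame cs) {n : ℕ} {i i' : B}

/-- The dihedral subgroup generated by the two factors. -/
def dihedral : Subgroup W := Subgroup.closure {F.factor true, F.factor false}

lemma factor_mem (b : Bool) : F.factor b ∈ F.dihedral :=
  Subgroup.subset_closure (by cases b <;> simp)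

lemma altProd_mem (b : Bool) (k : ℕ) : altProd F.factor b k ∈ F.dihedral := by
  induction k with
  | zero => exact one_mem _
  | succ k ih => exact mul_mem (F.factor_mem _) ih

/-- The orbit of `t` under conjugation by the dihedral subgroup. -/
def orbit (t : W) : Set W := {x | ∃ d ∈ F.dihedral, x = d * t * d⁻¹}

lemma orbit_conj {d : W} (hd : d ∈ F.dihedral) (t : W) : F.orbit (d * t * d⁻¹) = F.orbit t := by
  ext x
  constructor
  · rintro ⟨e, he, rfl⟩
    exact ⟨e * d, mul_mem he hd, by group⟩
  · rintro ⟨e, he, rfl⟩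
    exact ⟨e * d⁻¹, mul_mem he (inv_mem hd), by group⟩

/-- The reflection in the root `walkRoot i k`. -/
def walkRefl (i : B) (k : ℕ) : W :=
  altProd F.factor (!F.color i) k * cs.simple i * (altProd F.factor (!F.color i) k)⁻¹

lemma walkRefl_zero (i : B) : F.walkRefl i 0 = cs.simple i := by
  simp [walkRefl, altProd]

lemma factor_conj_walkRefl (i : B) (k : ℕ) :
    F.factor (!(F.color i ^^ k.bodd)) * F.walkRefl i k * (F.factor (!(F.color i ^^ k.bodd)))⁻¹
      = F.walkRefl i (k + 1) := by
  rw [walkRefl, walkRefl, altProd,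
    show ((!F.color i) ^^ k.bodd) = !(F.color i ^^ k.bodd) by
      cases F.color i <;> cases k.bodd <;> rfl]
  group

lemma factor_conj_walkRefl_succ (i : B) (k : ℕ) :
    F.factor (F.color i ^^ (k + 1).bodd) * F.walkRefl i (k + 1)
      * (F.factor (F.color i ^^ (k + 1).bodd))⁻¹ = F.walkRefl i k := by
  rw [← factor_conj_walkRefl, Nat.bodd_succ,
    show (F.color i ^^ !k.bodd) = !(F.color i ^^ k.bodd) by
      cases F.color i <;> cases k.bodd <;> rfl]
  have h := F.factor_mul_self (!(F.color i ^^ k.bodd))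
  rw [F.factor_inv]
  simp only [mul_assoc, h, mul_one]
  rw [← mul_assoc, h, one_mul]

lemma factor_conj_simple (i : B) :
    F.factor (F.color i) * cs.simple i * (F.factor (F.color i))⁻¹ = cs.simple i :=
  cs.conj_simple_eq_of_geomRep_eq_neg (F.geomRep_factor_single i)

variable {F}

lemma walkRefl_eq_simple (hi : F.walkRoot i n = Pi.single i' 1) :
    F.walkRefl i n = cs.simple i' :=
  cs.conj_simple_eq_of_geomRep_eq hi

lemma IsPeriod.exists_factor_conj (hn : F.IsPeriod n) (i : B) (b : Bool) {k : ℕ} (hk : k ≤ n) :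
    ∃ k' ≤ n, F.factor b * F.walkRefl i k * (F.factor b)⁻¹ = F.walkRefl i k' := by
  by_cases hb : b = (F.color i ^^ k.bodd)
  · subst hb
    cases k with
    | zero => exact ⟨0, hk, by simpa [walkRefl_zero] using F.factor_conj_simple i⟩
    | succ k => exact ⟨k, by omega, F.factor_conj_walkRefl_succ i k⟩
  · rw [show b = !(F.color i ^^ k.bodd) by
      revert hb; cases b <;> cases F.color i <;> cases k.bodd <;> simp]
    rcases hk.eq_or_lt with rfl | hk
    · obtain ⟨i', hi⟩ := hn.exists_partner i
      refine ⟨k, le_rfl, ?_⟩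
      rw [walkRefl_eq_simple hi, ← hn.color_partner hi, factor_conj_simple]
    · exact ⟨k + 1, hk, F.factor_conj_walkRefl i k⟩

lemma IsPeriod.orbit_simple (hn : F.IsPeriod n) (i : B) :
    F.orbit (cs.simple i) = F.walkRefl i '' Set.Iic n := by
  ext x
  constructor
  · rintro ⟨d, hd, rfl⟩
    induction hd using Subgroup.closure_induction_left with
    | one => exact ⟨0, Nat.zero_le n, by simp [walkRefl_zero]⟩
    | mul_left y hy d hd ih =>
      obtain ⟨k, hk, hk'⟩ := ih
      obtain ⟨b, rfl⟩ : ∃ b, y = F.factor b := by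
        rcases hy with rfl | rfl
        exacts [⟨_, rfl⟩, ⟨_, rfl⟩]
      obtain ⟨k', h1, h2⟩ := hn.exists_factor_conj i b hk
      refine ⟨k', h1, ?_⟩
      rw [← h2, hk']; group
    | inv_mul_cancel y hy d hd ih =>
      obtain ⟨k, hk, hk'⟩ := ih
      obtain ⟨b, rfl⟩ : ∃ b, y = F.factor b := by
        rcases hy with rfl | rfl
        exacts [⟨_, rfl⟩, ⟨_, rfl⟩]
      obtain ⟨k', h1, h2⟩ := hn.exists_factor_conj i b hk
      refine ⟨k', h1, ?_⟩
      rw [← h2, hk', F.factor_inv]; simp only [mul_inv_rev, F.factor_inv, mul_assoc]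
  · rintro ⟨k, -, rfl⟩
    exact ⟨_, F.altProd_mem _ k, rfl⟩

lemma IsPeriod.exists_eq_conj_simple (hn : F.IsPeriod n) {t : W} (ht : cs.IsReflection t) :
    ∃ i, ∃ d ∈ F.dihedral, t = d * cs.simple i * d⁻¹ := by
  obtain ⟨w, j, rfl, hw⟩ : ∃ w j, t = w * cs.simple j * w⁻¹ ∧
      0 ≤ cs.geomRep w (Pi.single j 1) := by
    obtain ⟨w, j, rfl⟩ := ht
    rcases cs.geomRep_single_nonneg_or_nonpos w j with h | h
    · exact ⟨w, j, rfl, h⟩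
    · refine ⟨w * cs.simple j, j, by simp [mul_assoc], ?_⟩
      rw [cs.geomRep_mul, cs.geomRep_simple_single_self, map_neg]
      exact neg_nonneg.2 h
  obtain ⟨l, hl, hl'⟩ : ∃ l, 0 ≤ cs.geomRep (altProd F.factor true l * w) (Pi.single j 1) ∧
      ¬ 0 ≤ cs.geomRep (altProd F.factor true (l + 1) * w) (Pi.single j 1) := by
    by_contra! h
    have hall : ∀ l, 0 ≤ cs.geomRep (altProd F.factor true l * w) (Pi.single j 1) := by
      intro l
      induction l with
      | zero => simpa [altProd] using hw
      | succ l ih => exact h l ih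
    have h1 := hn.geomRep_altProd_nonpos true hw
    rw [← cs.geomRep_mul] at h1
    exact cs.geomRep_single_ne_zero _ _ (le_antisymm h1 (hall (n + 1)))
  have h1 := (cs.geomRep_single_nonneg_or_nonpos _ _).resolve_left hl'
  rw [altProd, mul_assoc, cs.geomRep_mul] at h1
  have h2 := F.proj_nonpos (!(true ^^ l.bodd)) h1
  rw [proj_not_factor] at h2
  obtain ⟨i, hi⟩ := F.exists_eq_single_of_proj_eq_zero hl (le_antisymm h2 (F.proj_nonneg _ hl))
  refine ⟨i, (altProd F.factor true l)⁻¹, inv_mem (F.altProd_mem _ _), ?_⟩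
  rw [← cs.conj_simple_eq_of_geomRep_eq hi]
  group

lemma IsPeriod.walkRoot_eq_of_walkRefl_eq (hn : F.IsPeriod n) {j k : ℕ} (hj : j ≤ n)
    (hk : k ≤ n) (h : F.walkRefl i j = F.walkRefl i' k) : F.walkRoot i j = F.walkRoot i' k := by
  refine ((cs.conj_simple_eq_iff _ _ i i').1 h).resolve_right fun h ↦ ?_
  refine cs.geomRep_single_ne_zero _ i (le_antisymm ?_ (hn.walkRoot_nonneg i hj))
  rw [h]
  exact neg_nonpos.2 (hn.walkRoot_nonneg i' hk)

lemma IsPeriod.eq_of_walkRefl_eq (hn : F.IsPeriod n) (hi : F.walkRoot i n = Pi.single i' 1)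
    {j k : ℕ} (hj : j ≤ n) (hk : k ≤ n) (h : F.walkRefl i j = F.walkRefl i k) :
    j = k ∨ (j + k = n ∧ i' = i) := by
  have hr := hn.walkRoot_eq_of_walkRefl_eq hj hk h
  have hv := (F.vec_pos i).ne'
  obtain ⟨h1, h2⟩ := F.proj_walkRoot i j
  obtain ⟨h3, h4⟩ := F.proj_walkRoot i k
  rw [hr] at h1 h2
  by_cases hp : j.bodd = k.bodd
  · left
    rw [hp, h3] at h1
    rw [hp, h4] at h2
    have e1 := mul_left_cancel₀ hv h1
    have e2 := mul_left_cancel₀ hv h2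
    rcases lt_trichotomy j k with hlt | rfl | hlt
    · obtain ⟨m, rfl⟩ := Nat.exists_eq_add_of_lt hlt
      rw [show j + m + 1 = m + 1 + j by ring] at e1 e2
      exact absurd (chebSeq_eq_of_eq e2.symm e1.symm) (hn.2.1 _ (by omega) (by omega)).ne'
    · rfl
    · obtain ⟨m, rfl⟩ := Nat.exists_eq_add_of_lt hlt
      rw [show k + m + 1 = m + 1 + k by ring] at e1 e2
      exact absurd (chebSeq_eq_of_eq e2 e1) (hn.2.1 _ (by omega) (by omega)).ne'
  · right
    have hp' : k.bodd = !j.bodd := by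
      revert hp; cases j.bodd <;> cases k.bodd <;> simp
    rw [hp', show (F.color i ^^ !j.bodd) = !(F.color i ^^ j.bodd) by
      cases F.color i <;> cases j.bodd <;> rfl] at h3 h4
    rw [Bool.not_not, h1] at h4
    rw [h2] at h3
    have e := chebSeq_eq_of_eq_reverse (mul_left_cancel₀ hv h3) (mul_left_cancel₀ hv h4)
    have hjk : j + k = n := by
      rcases lt_trichotomy (j + k) n with hlt | he | hlt
      · exact absurd e (hn.2.1 _ (by omega) (by omega)).ne'
      · exact he
      · have := hn.2.2 (j + k - n)
        rw [show n + 1 + (j + k - n) = j + k + 1 by omega, e] at this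
        exact absurd this (by linarith [hn.2.1 (j + k - n) (by omega) (by omega)] : (0 : ℝ) > _).ne'
    refine ⟨hjk, ?_⟩
    have hc : F.color i' = F.color i := by
      rw [hn.color_partner hi, ← hjk, Nat.bodd_add, hp']
      cases F.color i <;> cases j.bodd <;> rfl
    have h5 : F.walkRoot i' j = F.walkRoot i j := by rw [hn.walkRoot_reverse hi hjk, hr]
    rw [walkRoot, walkRoot, hc] at h5
    have h6 := congrFun (cs.geomRep_injective_apply _ h5) i'
    by_contra hne
    simp [hne] at h6

lemma IsPeriod.eq_zero_or_eq_of_walkRefl_eq_simple (hn : F.IsPeriod n) {k : ℕ} (hk : k ≤ n)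
    (h : F.walkRefl i k = cs.simple i') : k = 0 ∨ k = n := by
  rw [← F.walkRefl_zero i'] at h
  have hr := hn.walkRoot_eq_of_walkRefl_eq hk (Nat.zero_le n) h
  rw [walkRoot_zero] at hr
  obtain ⟨h1, h2⟩ := F.proj_walkRoot i k
  have hz : F.proj (!F.color i') (F.walkRoot i k) = 0 := by simp [hr, proj_single]
  by_contra! hne
  have hp1 := mul_pos (F.vec_pos i) (hn.2.1 (k + 1) (by omega) (by omega))
  have hp2 := mul_pos (F.vec_pos i) (hn.2.1 k (by omega) (by omega))
  by_cases hc : (!F.color i') = (F.color i ^^ k.bodd)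
  · rw [hc, h1] at hz; exact hp1.ne' hz
  · rw [show (!F.color i') = !(F.color i ^^ k.bodd) by
      revert hc; cases F.color i' <;> cases F.color i <;> cases k.bodd <;> simp, h2] at hz
    exact hp2.ne' hz

lemma IsPeriod.orbit_inter_simple (hn : F.IsPeriod n) (hi : F.walkRoot i n = Pi.single i' 1) :
    F.orbit (cs.simple i) ∩ Set.range cs.simple = {cs.simple i, cs.simple i'} := by
  rw [hn.orbit_simple]
  ext x
  constructor
  · rintro ⟨⟨k, hk, rfl⟩, r, hr⟩
    rcases hn.eq_zero_or_eq_of_walkRefl_eq_simple hk hr.symm with rfl | rfl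
    · left; exact F.walkRefl_zero i
    · right; exact walkRefl_eq_simple hi
  · rintro (rfl | rfl)
    · exact ⟨⟨0, Nat.zero_le n, F.walkRefl_zero i⟩, i, rfl⟩
    · exact ⟨⟨n, Set.mem_Iic.2 le_rfl, walkRefl_eq_simple hi⟩, i', rfl⟩

lemma IsPeriod.ncard_orbit_of_ne (hn : F.IsPeriod n) (hi : F.walkRoot i n = Pi.single i' 1)
    (hne : i' ≠ i) : (F.orbit (cs.simple i)).ncard = n + 1 := by
  rw [hn.orbit_simple, Set.InjOn.ncard_image, ← Finset.coe_Iic, Set.ncard_coe_finset,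
    Nat.card_Iic]
  intro j hj k hk h
  exact (hn.eq_of_walkRefl_eq hi hj hk h).resolve_right fun h' ↦ hne h'.2

lemma IsPeriod.ncard_orbit_of_eq (hn : F.IsPeriod n) (hi : F.walkRoot i n = Pi.single i 1) :
    2 * (F.orbit (cs.simple i)).ncard = n + 1 := by
  have hodd : n.bodd = true := by
    have := hn.color_partner hi
    revert this; cases F.color i <;> cases n.bodd <;> simp
  obtain ⟨r, rfl⟩ : ∃ r, n = 2 * r + 1 := by
    have := Nat.bodd_add_div2 n
    rw [hodd] at this
    exact ⟨n.div2, by simp at this; omega⟩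
  have himg : F.walkRefl i '' Set.Iic (2 * r + 1) = F.walkRefl i '' Set.Iic r := by
    refine (Set.image_subset_iff.2 fun k hk ↦ ?_).antisymm
      (Set.image_mono (Set.Iic_subset_Iic.2 (by omega)))
    by_cases hkr : k ≤ r
    · exact ⟨k, hkr, rfl⟩
    · refine ⟨2 * r + 1 - k, Set.mem_Iic.2 (by omega), ?_⟩
      refine (cs.conj_simple_eq_iff _ _ i i).2 (Or.inl ?_)
      exact hn.walkRoot_reverse hi (Nat.sub_add_cancel hk)
  rw [hn.orbit_simple, himg, Set.InjOn.ncard_image, ← Finset.coe_Iic, Set.ncard_coe_finset,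
    Nat.card_Iic]
  · ring
  · intro j hj k hk h
    have hj' : j ≤ r := hj
    have hk' : k ≤ r := hk
    exact (hn.eq_of_walkRefl_eq hi (by omega) (by omega) h).resolve_right fun h' ↦ by omega

end BipartiteFrame

namespace CoxeterSystem

variable {B W : Type*} [Group W] {M : CoxeterMatrix B} (cs : CoxeterSystem M W)

lemma prod_map_simple_mul_self {l : List B}
    (hl : ∀ i ∈ l, ∀ j ∈ l, Commute (cs.simple i) (cs.simple j)) :
    (l.map cs.simple).prod * (l.map cs.simple).prod = 1 := by
  induction l with
  | nil => simp
  | cons a l ih =>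
    have hc : Commute (cs.simple a) (l.map cs.simple).prod := by
      refine Commute.list_prod_right _ _ fun x hx ↦ ?_
      obtain ⟨j, hj, rfl⟩ := List.mem_map.1 hx
      exact hl a (by simp) j (by simp [hj])
    rw [List.map_cons, List.prod_cons, mul_assoc, ← mul_assoc _ (cs.simple a), ← hc.eq, mul_assoc,
      ih fun i hi j hj ↦ hl i (by simp [hi]) j (by simp [hj])]
    simp

lemma geomRep_prod_map_simple [Fintype B] [DecidableEq B] {l : List B} (hnd : l.Nodup)
    (hl : ∀ i ∈ l, ∀ j ∈ l, i ≠ j → M.weight i j = 0) (x : B → ℝ) (i : B) :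
    cs.geomRep (l.map cs.simple).prod x i = if i ∈ l then x i + M.rootForm i x else x i := by
  induction l generalizing i with
  | nil => simp
  | cons a l ih =>
    obtain ⟨ha, hnd⟩ := List.nodup_cons.1 hnd
    have ih' := ih hnd fun i hi j hj ↦ hl i (by simp [hi]) j (by simp [hj])
    have hf : M.rootForm a (cs.geomRep (l.map cs.simple).prod x) = M.rootForm a x := by
      rw [M.rootForm_apply, M.rootForm_apply]
      refine Finset.sum_congr rfl fun j _ ↦ ?_
      rw [ih']
      split_ifs with hj
      · rw [hl a (by simp) j (by simp [hj]) (by rintro rfl; exact ha hj)]; ring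
      · rfl
    rw [List.map_cons, List.prod_cons, cs.geomRep_mul, cs.geomRep_simple, hf, Pi.add_apply, ih',
      Pi.smul_apply]
    by_cases hia : i = a
    · subst hia; simp [ha]
    · simp [hia]

end CoxeterSystem

/-- The frame attached to a bipartition of the simple reflections of an irreducible system. -/
lemma exists_bipartiteFrame {B W : Type*} [Group W] {M : CoxeterMatrix B} (cs : CoxeterSystem M W)
    [Finite W] [Fintype B] [DecidableEq B] [Nonempty B]
    (hirr : ∀ J K : Set B, J.Nonempty → K.Nonempty → Disjoint J K → J ∪ K = Set.univ →
      ¬ (∀ i ∈ J, ∀ j ∈ K, Commute (cs.simple i) (cs.simple j)))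
    {lp lm : List B} (hlpnd : lp.Nodup) (hlmnd : lm.Nodup) (hpart : ∀ i : B, i ∈ lp ↔ i ∉ lm)
    (hcommp : ∀ i ∈ lp, ∀ j ∈ lp, Commute (cs.simple i) (cs.simple j))
    (hcommm : ∀ i ∈ lm, ∀ j ∈ lm, Commute (cs.simple i) (cs.simple j)) :
    ∃ F : BipartiteFrame cs, F.factor true = (lp.map cs.simple).prod ∧
      F.factor false = (lm.map cs.simple).prod := by
  obtain ⟨v, μ, hv, heig⟩ := exists_pos_eigenvector M.weight M.weight_comm
    (fun i j h ↦ M.weight_nonneg h) (fun J hJ hJ' ↦ by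
      by_contra! h
      exact hirr J Jᶜ hJ hJ' disjoint_compl_right (Set.union_compl_self J)
        fun i hi j hj ↦ cs.commute_of_weight_eq_zero (h i hi j hj))
  have hp : ∀ i ∈ lp, ∀ j ∈ lp, i ≠ j → M.weight i j = 0 := fun i hi j hj h ↦
    cs.weight_eq_zero_of_commute h (hcommp i hi j hj)
  have hm : ∀ i ∈ lm, ∀ j ∈ lm, i ≠ j → M.weight i j = 0 := fun i hi j hj h ↦
    cs.weight_eq_zero_of_commute h (hcommm i hi j hj)
  have hpart' : ∀ i, i ∉ lp ↔ i ∈ lm := fun i ↦ by rw [hpart, not_not]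
  refine ⟨{
    color := fun i ↦ decide (i ∈ lp)
    factor := fun b ↦ ((if b then lp else lm).map cs.simple).prod
    weight_eq_zero := fun i j hij hne ↦ ?_
    factor_mul_self := fun b ↦ ?_
    geomRep_factor := fun b x i ↦ ?_
    vec := v
    vec_pos := hv
    eig := μ + 2
    eigen := fun i ↦ by rw [heig]; ring }, rfl, rfl⟩
  · by_cases hi : i ∈ lp
    · exact hp i hi j (by simpa [hi] using hij) hne
    · exact hm i ((hpart' i).1 hi) j ((hpart' j).1 (by simpa [hi] using hij)) hne
  · cases b
    · exact cs.prod_map_simple_mul_self hcommm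
    · exact cs.prod_map_simple_mul_self hcommp
  · cases b
    · simp [cs.geomRep_prod_map_simple hlmnd hm, hpart']
    · simp [cs.geomRep_prod_map_simple hlpnd hp]

/-- In a finite irreducible Coxeter system with bipartite Coxeter element
`c = c₋ c₊` of order `h`, the orbit of any reflection `t` under the conjugation action of
`⟨c₊, c₋⟩` either (i) has `h/2` elements (so `h` is even) and contains exactly one simple
reflection `s`, which satisfies `w₀ s w₀⁻¹ = s`; or (ii) has `h` elements and contains
exactly two simple reflections `s ≠ s'`, which satisfy `w₀ s w₀⁻¹ = s'`; and exactly one of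
(i), (ii) holds. -/
theorem orbit_of_reflection_under_bipartite_dihedral
    {B : Type*} {W : Type*} [Group W] {M : CoxeterMatrix B}
    (cs : CoxeterSystem M W) [Finite W] [Finite B]
    (hirr : ∀ J K : Set B, J.Nonempty → K.Nonempty → Disjoint J K → J ∪ K = Set.univ →
      ¬ (∀ i ∈ J, ∀ j ∈ K, Commute (cs.simple i) (cs.simple j)))
    (lp lm : List B) (hlpnd : lp.Nodup) (hlmnd : lm.Nodup)
    (hpart : ∀ i : B, i ∈ lp ↔ i ∉ lm)
    (hcommp : ∀ i ∈ lp, ∀ j ∈ lp, Commute (cs.simple i) (cs.simple j))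
    (hcommm : ∀ i ∈ lm, ∀ j ∈ lm, Commute (cs.simple i) (cs.simple j))
    (cplus cminus c : W)
    (hcplus : cplus = (lp.map cs.simple).prod)
    (hcminus : cminus = (lm.map cs.simple).prod)
    (hc : c = cminus * cplus)
    (w0 : W) (hw0 : ∀ u : W, cs.length u ≤ cs.length w0)
    (t : W) (ht : cs.IsReflection t) :
    Xor'
      (2 * {x : W | ∃ d ∈ Subgroup.closure {cplus, cminus}, x = d * t * d⁻¹}.ncard = orderOf c ∧
        ∃ s ∈ Set.range cs.simple,
          {x : W | ∃ d ∈ Subgroup.closure {cplus, cminus}, x = d * t * d⁻¹} ∩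
              Set.range cs.simple = {s} ∧
          w0 * s * w0⁻¹ = s)
      ({x : W | ∃ d ∈ Subgroup.closure {cplus, cminus}, x = d * t * d⁻¹}.ncard = orderOf c ∧
        ∃ s ∈ Set.range cs.simple, ∃ s' ∈ Set.range cs.simple, s ≠ s' ∧
          {x : W | ∃ d ∈ Subgroup.closure {cplus, cminus}, x = d * t * d⁻¹} ∩
              Set.range cs.simple = {s, s'} ∧
          w0 * s * w0⁻¹ = s') := by
  classical
  have := Fintype.ofFinite B
  have : Nonempty B := by obtain ⟨-, i, -⟩ := ht; exact ⟨i⟩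
  obtain ⟨F, hF, hF'⟩ := exists_bipartiteFrame cs hirr hlpnd hlmnd hpart hcommp hcommm
  rw [← hF] at hcplus
  rw [← hF'] at hcminus
  subst hcplus hcminus hc
  obtain ⟨n, hn⟩ := F.exists_isPeriod (Classical.arbitrary B)
  obtain ⟨i, d, hd, rfl⟩ := hn.exists_eq_conj_simple ht
  change Xor (2 * (F.orbit _).ncard = _ ∧ ∃ s ∈ _, F.orbit _ ∩ _ = _ ∧ _)
    ((F.orbit _).ncard = _ ∧ ∃ s ∈ _, ∃ s' ∈ _, _ ∧ F.orbit _ ∩ _ = _ ∧ _)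
  rw [F.orbit_conj hd, hn.orderOf_eq]
  obtain ⟨i', hi⟩ := hn.exists_partner i
  have hinter := hn.orbit_inter_simple hi
  have hconj := hn.longest_conj hw0 hi
  by_cases hii : i' = i
  · subst hii
    have hcard := hn.ncard_orbit_of_eq hi
    rw [Set.pair_eq_singleton] at hinter
    exact Or.inl ⟨⟨hcard, _, ⟨i', rfl⟩, hinter, hconj⟩, fun h ↦ by have := h.1; omega⟩
  · have hcard := hn.ncard_orbit_of_ne hi hii
    exact Or.inr ⟨⟨hcard, _, ⟨i, rfl⟩, _, ⟨i', rfl⟩,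
      fun h ↦ hii (cs.simple_injective_of_fintype h).symm, hinter, hconj⟩,
      fun h ↦ by have := h.1; omega⟩
end

section
/- Every reflection t ∈ T is of the form cᵏ s c⁻ᵏ for some simple reflection s ∈ S and some integer k, where c = c₋c₊ is the bipartite Coxeter element. -/
open CoxeterSystem

open Module Polynomial.Chebyshev

namespace CoxeterMatrix

variable {B : Type*} [Fintype B] [DecidableEq B] (M : CoxeterMatrix B)

/-- The linear form `v ↦ 2⟨αᵢ, v⟩` of the geometric representation, where
`⟨αᵢ, αⱼ⟩ = -cos (π / M i j)` (which is `-1` when `M i j = 0` encodes `∞`). -/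
noncomputable def simpleCoroot (i : B) : Dual ℝ (B → ℝ) :=
  ∑ j, (-2 * Real.cos (Real.pi / M i j)) • LinearMap.proj j

theorem simpleCoroot_single (i j : B) :
    M.simpleCoroot i (Pi.single j 1) = -2 * Real.cos (Real.pi / M i j) := by
  simp [simpleCoroot, Pi.single_apply]

theorem simpleCoroot_single_self (i : B) : M.simpleCoroot i (Pi.single i 1) = 2 := by
  simp [simpleCoroot_single]

/-- The simple reflection `v ↦ v - 2⟨αᵢ, v⟩ αᵢ` of the geometric representation. -/
noncomputable def simpleReflection (i : B) : (B → ℝ) ≃ₗ[ℝ] (B → ℝ) :=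
  reflection (M.simpleCoroot_single_self i)

theorem simpleReflection_apply (i : B) (v : B → ℝ) :
    M.simpleReflection i v = v - M.simpleCoroot i v • Pi.single i 1 :=
  reflection_apply ..

theorem isLiftable_simpleReflection : M.IsLiftable M.simpleReflection := by
  intro i j
  obtain rfl | hij := eq_or_ne i j
  · rw [M.diagonal, pow_one]
    ext1 v
    exact involutive_reflection (M.simpleCoroot_single_self i) v
  obtain h0 | h0 := eq_or_ne (M i j) 0
  · simp [h0]
  obtain h2 | h2 := eq_or_ne (M i j) 2
  · have hij0 : M.simpleCoroot i (Pi.single j 1) = 0 := by simp [simpleCoroot_single, h2]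
    have hji0 : M.simpleCoroot j (Pi.single i 1) = 0 := by
      simp [simpleCoroot_single, M.symmetric j i, h2]
    ext1 v
    rw [h2, sq]
    simp only [LinearEquiv.mul_apply, LinearEquiv.coe_one, id, simpleReflection_apply, map_sub,
      map_smul, hij0, hji0, simpleCoroot_single_self]
    module
  have h3 : 3 ≤ M i j := by have := M.off_diagonal i j hij; lia
  set m := M i j with hm
  set φ : ℝ := 2 * (Real.pi / m) with hφ
  have hm0 : (0 : ℝ) < m := by positivity
  have hmφ : m * φ = 2 * Real.pi := by rw [hφ]; field_simp
  have hsin : Real.sin φ ≠ 0 := by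
    refine (Real.sin_pos_of_pos_of_lt_pi (by positivity) ?_).ne'
    have : (3 : ℝ) ≤ m := by exact_mod_cast h3
    nlinarith [Real.pi_pos]
  have ht : 2 * Real.cos φ = M.simpleCoroot i (Pi.single j 1) *
      M.simpleCoroot j (Pi.single i 1) - 2 := by
    rw [simpleCoroot_single, simpleCoroot_single, M.symmetric j i, ← hm, hφ, Real.cos_two_mul]
    ring
  have hS (k : ℤ) := S_two_mul_real_cos φ k
  ext1 v
  rw [simpleReflection, simpleReflection, reflection_mul_reflection_pow_apply _ _ _ _ _ ht]
  obtain ⟨q, hq | hq⟩ := Nat.even_or_odd' m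
  · have e1 : ((m : ℤ) - 2) / 2 = q - 1 := by lia
    have e2 : ((m : ℤ) - 1) / 2 = q - 1 := by lia
    have hz : (S ℝ (q - 1)).eval (2 * Real.cos φ) = 0 := by
      have := hS (q - 1)
      have hqφ : ((q - 1 : ℤ) + 1 : ℝ) * φ = Real.pi := by
        have : (m : ℝ) = 2 * q := by exact_mod_cast hq
        push_cast
        rw [this] at hmφ
        linarith
      rw [hqφ, Real.sin_pi] at this
      exact (mul_eq_zero.mp this).resolve_right hsin
    simp [e1, e2, hz]
  · have e1 : ((m : ℤ) - 2) / 2 = q - 1 := by lia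
    have e2 : ((m : ℤ) - 1) / 2 = q := by lia
    have e3 : ((m : ℤ) - 3) / 2 = q - 1 := by lia
    have e4 : (m : ℤ) / 2 = q := by lia
    have hz : (S ℝ q).eval (2 * Real.cos φ) + (S ℝ (q - 1)).eval (2 * Real.cos φ) = 0 := by
      have h1 := hS q
      have h2 := hS (q - 1)
      have : (m : ℝ) = 2 * q + 1 := by exact_mod_cast hq
      have hqφ : ((q - 1 : ℤ) + 1 : ℝ) * φ = 2 * Real.pi - ((q : ℤ) + 1 : ℝ) * φ := by
        rw [this] at hmφ
        push_cast
        linarith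
      rw [hqφ, Real.sin_two_pi_sub] at h2
      refine (mul_eq_zero.mp (?_ : _ * Real.sin φ = 0)).resolve_right hsin
      linear_combination h1 + h2
    simp [e1, e2, e3, e4, hz]

end CoxeterMatrix

namespace CoxeterSystem

variable {B W : Type*} [Fintype B] [DecidableEq B] [Group W] {M : CoxeterMatrix B}
  (cs : CoxeterSystem M W)

/-- The geometric representation, in which the basis vector `Pi.single i 1` is the simple root
`αᵢ`. -/
noncomputable def geometricRep : W →* ((B → ℝ) ≃ₗ[ℝ] (B → ℝ)) :=
  cs.lift ⟨M.simpleReflection, M.isLiftable_simpleReflection⟩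

theorem geometricRep_simple (i : B) (v : B → ℝ) :
    cs.geometricRep (cs.simple i) v = v - M.simpleCoroot i v • Pi.single i 1 := by
  rw [geometricRep, lift_apply_simple, M.simpleReflection_apply]

theorem geometricRep_simple_single (i : B) :
    cs.geometricRep (cs.simple i) (Pi.single i 1) = -Pi.single i 1 := by
  rw [geometricRep_simple, M.simpleCoroot_single_self, two_smul]
  abel

theorem geometricRep_mul_apply (w w' : W) (v : B → ℝ) :
    cs.geometricRep (w * w') v = cs.geometricRep w (cs.geometricRep w' v) := by
  rw [map_mul, LinearEquiv.mul_apply]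

theorem geometricRep_alternatingWord (i j : B) (k : ℕ) :
    cs.geometricRep (cs.wordProd (alternatingWord i j k)) (Pi.single i 1) =
      (S ℝ k).eval (2 * Real.cos (Real.pi / M i j)) •
        Pi.single (if Even k then i else j) (1 : ℝ) +
      (S ℝ (k - 1)).eval (2 * Real.cos (Real.pi / M i j)) •
        Pi.single (if Even k then j else i) (1 : ℝ) := by
  induction k with
  | zero => simp [alternatingWord]
  | succ k ih =>
    rw [alternatingWord_succ', wordProd_cons, geometricRep_mul_apply, ih, map_add, map_smul,
      map_smul, geometricRep_simple_single, geometricRep_simple, M.simpleCoroot_single]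
    have hS : (S ℝ (k + 1)).eval (2 * Real.cos (Real.pi / M i j)) =
        2 * Real.cos (Real.pi / M i j) * (S ℝ k).eval (2 * Real.cos (Real.pi / M i j)) -
        (S ℝ (k - 1)).eval (2 * Real.cos (Real.pi / M i j)) := by
      simp [S_add_one]
    have hM : M (if Even k then j else i) (if Even k then i else j) = M i j := by
      split_ifs
      · exact M.symmetric j i
      · rfl
    push_cast
    rw [hM, hS, add_sub_cancel_right]
    by_cases hk : Even k
    · simp only [hk, Nat.even_add_one, not_true, if_true, if_false]
      module
    · simp only [hk, Nat.even_add_one, not_false_iff, if_true, if_false]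
      module
theorem eval_S_two_mul_cos_pi_div_nonneg {m : ℕ} (hm : m ≠ 1) {k : ℤ} (hk : -1 ≤ k)
    (hkm : m ≠ 0 → k < m) : 0 ≤ (S ℝ k).eval (2 * Real.cos (Real.pi / m)) := by
  have hk' : (0 : ℝ) ≤ k + 1 := by exact_mod_cast (by lia : (0 : ℤ) ≤ k + 1)
  obtain rfl | hm0 := eq_or_ne m 0
  · simpa using hk'
  have hm2 : (2 : ℝ) ≤ m := by exact_mod_cast (by lia : 2 ≤ m)
  have hkm' : (k + 1 : ℝ) ≤ m := by exact_mod_cast (by have := hkm hm0; lia : k + 1 ≤ (m : ℤ))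
  have hsin : 0 < Real.sin (Real.pi / m) := by
    refine Real.sin_pos_of_pos_of_lt_pi (by positivity) (div_lt_self Real.pi_pos (by linarith))
  refine nonneg_of_mul_nonneg_left (b := Real.sin (Real.pi / m)) ?_ hsin
  rw [S_two_mul_real_cos]
  refine Real.sin_nonneg_of_nonneg_of_le_pi (by positivity) ?_
  rw [← mul_div_assoc, div_le_iff₀ (by positivity), mul_comm]
  exact mul_le_mul_of_nonneg_left hkm' Real.pi_pos.le

/-- If `w sᵢ` is longer than `w`, then `w αᵢ` is a nonnegative combination of simple roots. -/
theorem geometricRep_single_nonneg {w : W} {i : B} (h : ¬ cs.IsRightDescent w i) :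
    0 ≤ cs.geometricRep w (Pi.single i 1) := by
  induction hn : cs.length w using Nat.strong_induction_on generalizing w i with
  | h n ih =>
    subst hn
    obtain rfl | hw := eq_or_ne w 1
    · simp
    obtain ⟨j, hj⟩ := cs.exists_rightDescent_of_ne_one hw
    have hij : i ≠ j := by rintro rfl; exact h hj
    -- Strip from the right of `w` the longest possible reduced word in `i` and `j`.
    let P (k : ℕ) : Prop :=
      ∃ v, w = v * cs.wordProd (alternatingWord i j k) ∧ cs.length w = cs.length v + k
    have hP1 : P 1 := by
      refine ⟨w * cs.simple j, ?_, (cs.isRightDescent_iff.mp hj).symm⟩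
      simp [alternatingWord]
    have hPle (k : ℕ) (hk : P k) : k ≤ cs.length w := by
      obtain ⟨v, -, hv⟩ := hk
      lia
    classical
    set k := Nat.findGreatest P (cs.length w) with hk
    have hPk : P k := Nat.findGreatest_spec (hPle 1 hP1) hP1
    have hk1 : 1 ≤ k := Nat.le_findGreatest (hPle 1 hP1) hP1
    have hPk' : ¬ P (k + 1) := fun h' ↦
      absurd (Nat.le_findGreatest (hPle _ h') h') (by lia)
    obtain ⟨v, hwv, hlv⟩ := hPk
    set a := if Even k then i else j with ha
    set b := if Even k then j else i with hb
    have hvb : ¬ cs.IsRightDescent v b := by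
      intro hd
      rw [isRightDescent_iff] at hd
      refine hPk' ⟨v * cs.simple b, ?_, by lia⟩
      rw [alternatingWord_succ', wordProd_cons, ← hb, ← mul_assoc, simple_mul_simple_cancel_right,
        hwv]
    have hva : ¬ cs.IsRightDescent v a := by
      intro hd
      rw [isRightDescent_iff] at hd
      obtain ⟨l, hl⟩ : ∃ l, k = l + 1 := ⟨k - 1, by lia⟩
      have ha' : (if Even l then j else i) = a := by
        simp only [ha, hl, Nat.even_add_one]
        split_ifs <;> rfl
      have hlen : cs.length w ≤ cs.length (v * cs.simple a) + l := by
        rw [hwv, hl, alternatingWord_succ', wordProd_cons, ha', ← mul_assoc]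
        refine (cs.length_mul_le _ _).trans (Nat.add_le_add_left ?_ _)
        simpa using cs.length_wordProd_le (alternatingWord i j l)
      lia
    have hkM : M i j ≠ 0 → k < M i j := by
      intro hM0
      by_contra! hle
      have hlt := (cs.length_wordProd_le _).lt_of_ne
        (cs.not_isReduced_alternatingWord j i (m := k + 1) (M.symmetric i j ▸ hM0)
          (by rw [M.symmetric j i]; lia))
      rw [length_alternatingWord, alternatingWord_succ, wordProd_concat] at hlt
      have hwi := cs.not_isRightDescent_iff.mp h
      have := cs.length_mul_le v (cs.wordProd (alternatingWord i j k) * cs.simple i)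
      rw [← mul_assoc, ← hwv] at this
      lia
    rw [hwv, geometricRep_mul_apply, geometricRep_alternatingWord, map_add, map_smul, map_smul]
    have hM1 := M.off_diagonal i j hij
    exact add_nonneg
      (smul_nonneg (eval_S_two_mul_cos_pi_div_nonneg hM1 (by lia) (by lia))
        (ih _ (by lia) hva rfl))
      (smul_nonneg (eval_S_two_mul_cos_pi_div_nonneg hM1 (by lia) (by lia))
        (ih _ (by lia) hvb rfl))

theorem geometricRep_single_nonpos {w : W} {i : B} (h : cs.IsRightDescent w i) :
    cs.geometricRep w (Pi.single i 1) ≤ 0 := by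
  have := cs.geometricRep_single_nonneg (cs.isRightDescent_iff_not_isRightDescent_mul.mp h)
  rwa [geometricRep_mul_apply, geometricRep_simple_single, map_neg, Left.nonneg_neg_iff] at this

theorem geometricRep_single_nonneg_or_nonpos (w : W) (i : B) :
    0 ≤ cs.geometricRep w (Pi.single i 1) ∨ cs.geometricRep w (Pi.single i 1) ≤ 0 := by
  by_cases h : cs.IsRightDescent w i
  · exact .inr (cs.geometricRep_single_nonpos h)
  · exact .inl (cs.geometricRep_single_nonneg h)

theorem geometricRep_single_ne_zero (w : W) (i : B) :
    cs.geometricRep w (Pi.single i 1) ≠ 0 := by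
  simp

/-- A reflection whose root is proportional to the simple root `αⱼ` is `sⱼ`. -/
theorem conj_simple_eq_simple {w : W} {i j : B} {r : ℝ}
    (h : cs.geometricRep w (Pi.single i 1) = r • Pi.single j 1) :
    w * cs.simple i * w⁻¹ = cs.simple j := by
  have hr : r ≠ 0 := by
    rintro rfl
    exact cs.geometricRep_single_ne_zero w i (by simpa only [zero_smul] using h)
  have hu (v : B → ℝ) : ∃ x : ℝ,
      cs.geometricRep (cs.simple j * (w * cs.simple i * w⁻¹)) v = v + x • Pi.single j 1 := by
    have hw : cs.geometricRep w (cs.geometricRep w⁻¹ v) = v := by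
      rw [← geometricRep_mul_apply, mul_inv_cancel, map_one, LinearEquiv.coe_one, id]
    simp only [geometricRep_mul_apply, geometricRep_simple, map_sub, map_smul, hw, h,
      M.simpleCoroot_single_self]
    exact ⟨M.simpleCoroot i (cs.geometricRep w⁻¹ v) * r - M.simpleCoroot j v, by module⟩
  have hj : cs.geometricRep (cs.simple j * (w * cs.simple i * w⁻¹)) (Pi.single j 1) =
      Pi.single j 1 := by
    have hw : cs.geometricRep w⁻¹ (r • Pi.single j 1) = Pi.single i 1 := by
      rw [← h, ← geometricRep_mul_apply, inv_mul_cancel, map_one, LinearEquiv.coe_one, id]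
    refine smul_right_injective _ hr ?_
    dsimp only
    rw [← map_smul, geometricRep_mul_apply, geometricRep_mul_apply, geometricRep_mul_apply, hw,
      geometricRep_simple_single, map_neg, h, map_neg, map_smul, geometricRep_simple_single,
      smul_neg, neg_neg]
  have h1 : cs.simple j * (w * cs.simple i * w⁻¹) = 1 := by
    by_contra hne
    obtain ⟨l, hl⟩ := cs.exists_rightDescent_of_ne_one hne
    have hneg := cs.geometricRep_single_nonpos hl l
    obtain rfl | hjl := eq_or_ne l j
    · rw [hj] at hneg
      norm_num at hneg
    · obtain ⟨x, hx⟩ := hu (Pi.single l 1)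
      rw [hx] at hneg
      norm_num [hjl] at hneg
  rw [← inv_eq_of_mul_eq_one_right h1, inv_simple]

/-- Applying `sⱼ` preserves the sign of every positive root not proportional to `αⱼ`. -/
theorem geometricRep_simple_mul_single_nonneg {w : W} {i j : B}
    (h : 0 ≤ cs.geometricRep w (Pi.single i 1)) (hne : w * cs.simple i * w⁻¹ ≠ cs.simple j) :
    0 ≤ cs.geometricRep (cs.simple j * w) (Pi.single i 1) := by
  refine (cs.geometricRep_single_nonneg_or_nonpos _ i).resolve_right fun hneg ↦ hne ?_
  refine cs.conj_simple_eq_simple (r := cs.geometricRep w (Pi.single i 1) j) ?_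
  rw [geometricRep_mul_apply, geometricRep_simple] at hneg
  ext l
  obtain rfl | hl := eq_or_ne l j
  · simp
  · have h1 := h l
    have h2 := hneg l
    simp [hl] at h1 h2 ⊢
    exact le_antisymm h2 h1

/-- The product of a word in pairwise commuting simple reflections preserves the sign of every
positive root not proportional to one of the corresponding simple roots. -/
theorem geometricRep_wordProd_mul_single_nonneg {l : List B}
    (hl : ∀ a ∈ l, ∀ b ∈ l, Commute (cs.simple a) (cs.simple b)) {w : W} {i : B}
    (h : 0 ≤ cs.geometricRep w (Pi.single i 1))
    (hne : ∀ a ∈ l, w * cs.simple i * w⁻¹ ≠ cs.simple a) :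
    0 ≤ cs.geometricRep (cs.wordProd l * w) (Pi.single i 1) := by
  induction l with
  | nil => simpa using h
  | cons a l ih =>
    simp only [List.forall_mem_cons] at hl hne
    rw [wordProd_cons, mul_assoc]
    refine cs.geometricRep_simple_mul_single_nonneg
      (ih (fun b hb ↦ (hl.2 b hb).2) hne.2) fun heq ↦ hne.1 ?_
    have hcomm : Commute (cs.wordProd l) (cs.simple a) :=
      Commute.list_prod_left _ _ (by simpa using fun b hb ↦ (hl.2 b hb).1)
    rw [mul_inv_rev, ← mul_assoc, mul_inv_eq_iff_eq_mul, ← hcomm.eq] at heq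
    simpa only [mul_assoc, mul_left_cancel_iff] using heq

theorem geometricRep_wordProd_apply_eq {l : List B} (v : B → ℝ) {j : B} (hj : j ∉ l) :
    cs.geometricRep (cs.wordProd l) v j = v j := by
  induction l with
  | nil => simp
  | cons a l ih =>
    simp only [List.mem_cons, not_or] at hj
    simp [wordProd_cons, geometricRep_simple, ih hj.2, hj.1]

/-- A vector fixed by a product of distinct simple reflections is fixed by each of them. -/
theorem geometricRep_simple_eq_self_of_wordProd {l : List B} (hl : l.Nodup) {v : B → ℝ}
    (h : cs.geometricRep (cs.wordProd l) v = v) :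
    ∀ a ∈ l, cs.geometricRep (cs.simple a) v = v := by
  induction l with
  | nil => simp
  | cons a l ih =>
    obtain ⟨hal, hl⟩ := List.nodup_cons.mp hl
    have hlv : cs.geometricRep (cs.wordProd l) v = v := by
      rw [wordProd_cons, geometricRep_mul_apply, geometricRep_simple] at h
      have ha := congrFun h a
      simp [cs.geometricRep_wordProd_apply_eq v hal] at ha
      simpa [ha] using h
    rw [wordProd_cons, geometricRep_mul_apply, hlv] at h
    simpa [h] using ih hl hlv

/-- The geometric representation of a finite Coxeter group has no nonzero invariant vector. -/
theorem eq_zero_of_forall_geometricRep_simple_eq_self [Finite W] {v : B → ℝ}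
    (h : ∀ i, cs.geometricRep (cs.simple i) v = v) : v = 0 := by
  have := Fintype.ofFinite W
  have hsum : (∑ w, (cs.geometricRep w).toLinearMap) = 0 := by
    refine (Pi.basisFun ℝ B).ext fun i ↦ ?_
    have hneg : ∑ w, cs.geometricRep w (Pi.single i 1) =
        -∑ w, cs.geometricRep w (Pi.single i 1) := by
      rw [← Finset.sum_neg_distrib, ← Equiv.sum_comp (Equiv.mulRight (cs.simple i))]
      simp [geometricRep_simple_single]
    simpa using self_eq_neg.mp hneg
  have hfix (w : W) : cs.geometricRep w v = v := by
    induction w using cs.simple_induction_left with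
    | one => simp
    | mul_simple_left w i ih => rw [geometricRep_mul_apply, ih, h]
  have hcard : Fintype.card W • v = 0 := by
    have := LinearMap.congr_fun hsum v
    simpa only [LinearMap.sum_apply, LinearEquiv.coe_coe, hfix, Finset.sum_const,
      Finset.card_univ, LinearMap.zero_apply] using this
  exact (smul_eq_zero.mp hcard).resolve_left Fintype.card_ne_zero

end CoxeterSystem

/-- In a finite irreducible Coxeter system with bipartite Coxeter element
`c = c₋ c₊`, every reflection `t` has the form `cᵏ s c⁻ᵏ` for some simple reflection `s`
and some integer `k`. -/
theorem reflection_eq_zpow_conj_simple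
    {B : Type*} {W : Type*} [Group W] {M : CoxeterMatrix B}
    (cs : CoxeterSystem M W) [Finite W] [Finite B]
    (hirr : ∀ J K : Set B, J.Nonempty → K.Nonempty → Disjoint J K → J ∪ K = Set.univ →
      ¬ (∀ i ∈ J, ∀ j ∈ K, Commute (cs.simple i) (cs.simple j)))
    (lp lm : List B) (hlpnd : lp.Nodup) (hlmnd : lm.Nodup)
    (hpart : ∀ i : B, i ∈ lp ↔ i ∉ lm)
    (hcommp : ∀ i ∈ lp, ∀ j ∈ lp, Commute (cs.simple i) (cs.simple j))
    (hcommm : ∀ i ∈ lm, ∀ j ∈ lm, Commute (cs.simple i) (cs.simple j))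
    (cplus cminus c : W)
    (hcplus : cplus = (lp.map cs.simple).prod)
    (hcminus : cminus = (lm.map cs.simple).prod)
    (hc : c = cminus * cplus)
    (t : W) (ht : cs.IsReflection t) :
    ∃ (i : B) (k : ℤ), t = c ^ k * cs.simple i * (c ^ k)⁻¹ := by
  classical
  have := Fintype.ofFinite B
  obtain ⟨w, i, rfl⟩ := ht
  by_contra! hne
  change cplus = cs.wordProd lp at hcplus
  change cminus = cs.wordProd lm at hcminus
  -- We may take the root `w αᵢ` of the reflection to be positive.
  wlog hpos : 0 ≤ cs.geometricRep w (Pi.single i 1) generalizing w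
  · refine this (w * cs.simple i) (by simpa [mul_assoc] using hne) ?_
    rw [geometricRep_mul_apply, geometricRep_simple_single, map_neg, Left.nonneg_neg_iff]
    exact (cs.geometricRep_single_nonneg_or_nonpos w i).resolve_left hpos
  have hcm (a : B) (ha : a ∈ lm) : Commute cminus (cs.simple a) := by
    rw [hcminus]
    exact Commute.list_prod_left _ _ (by simpa using fun b hb ↦ hcommm b hb a ha)
  -- All the roots `cᵏ w αᵢ` are then positive.
  have hck (k : ℕ) : 0 ≤ cs.geometricRep (c ^ k * w) (Pi.single i 1) := by
    induction k with
    | zero => simpa using hpos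
    | succ k ih =>
      rw [pow_succ', mul_assoc, hc, mul_assoc, ← hc, hcminus]
      refine cs.geometricRep_wordProd_mul_single_nonneg hcommm ?_ fun a ha heq ↦ ?_
      · rw [hcplus]
        refine cs.geometricRep_wordProd_mul_single_nonneg hcommp ih fun a _ heq ↦ ?_
        refine hne a (-k) ?_
        rw [← heq, zpow_neg, zpow_natCast]
        group
      · refine hne a (-(k + 1 : ℕ)) ?_
        have hca : cminus⁻¹ * cs.simple a * cminus = cs.simple a := by
          rw [mul_assoc, ← (hcm a ha).eq, inv_mul_cancel_left]
        rw [zpow_neg, zpow_natCast, inv_inv, pow_succ']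
        nth_rw 1 [hc]
        nth_rw 2 [hc]
        calc w * cs.simple i * w⁻¹
            = (c ^ k)⁻¹ * cplus⁻¹ *
              (cplus * (c ^ k * w) * cs.simple i * (cplus * (c ^ k * w))⁻¹) *
                cplus * c ^ k := by group
          _ = (c ^ k)⁻¹ * cplus⁻¹ * (cminus⁻¹ * cs.simple a * cminus) * cplus * c ^ k := by
            rw [heq, hca]
          _ = _ := by group
  set v := ∑ k ∈ Finset.range (orderOf c), cs.geometricRep (c ^ k * w) (Pi.single i 1) with hv
  have hcv : cs.geometricRep c v = v := by
    simp only [hv, map_sum, ← geometricRep_mul_apply, ← mul_assoc, ← pow_succ']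
    have h1 := Finset.sum_range_succ (fun k ↦ cs.geometricRep (c ^ k * w) (Pi.single i (1 : ℝ)))
      (orderOf c)
    rw [Finset.sum_range_succ', pow_orderOf_eq_one, pow_zero] at h1
    exact add_right_cancel h1
  have hnodup : (lm ++ lp).Nodup :=
    hlmnd.append hlpnd fun a ha ha' ↦ (hpart a).mp ha' ha
  have hv0 : v = 0 := by
    refine cs.eq_zero_of_forall_geometricRep_simple_eq_self fun a ↦
      cs.geometricRep_simple_eq_self_of_wordProd hnodup ?_ a ?_
    · rw [wordProd_append, ← hcminus, ← hcplus, ← hc, hcv]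
    · rw [List.mem_append, hpart]
      exact em _
  have h0 := (Finset.sum_eq_zero_iff_of_nonneg fun k _ ↦ hck k).mp hv0 0
    (Finset.mem_range.mpr (orderOf_pos c))
  exact cs.geometricRep_single_ne_zero _ i h0
end

section
/- Let c = c₋c₊ be the bipartite Coxeter element. For each ε ∈ {+,−}, a parabolic subgroup W′ of W is noncrossing with respect to c if and only if c_ε W′ c_ε is noncrossing with respect to c; that is, the conjugation action of the subgroup ⟨c₊, c₋⟩ preserves the crossing/noncrossing status of parabolic subgroups. -/
open CoxeterSystem

variable {B : Type*} {W : Type*} [Group W] {M : CoxeterMatrix B}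

/-- The absolute length of `w`: the minimal length of a word in the reflections
`T = {w s w⁻¹ : s ∈ S, w ∈ W}` whose product is `w`. -/
noncomputable def absLength (cs : CoxeterSystem M W) (w : W) : ℕ :=
  sInf {k : ℕ | ∃ l : List W, (∀ t ∈ l, cs.IsReflection t) ∧ l.length = k ∧ l.prod = w}

/-- The absolute order on `W`: `u ≤_T v` iff `ℓ_T(u) + ℓ_T(u⁻¹ v) = ℓ_T(v)`. -/
def absLe (cs : CoxeterSystem M W) (u v : W) : Prop :=
  absLength cs u + absLength cs (u⁻¹ * v) = absLength cs v

/-- A Coxeter element: a product of all the simple reflections, each occurring exactly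
once, in some order. -/
def IsCoxeterElement (cs : CoxeterSystem M W) (c : W) : Prop :=
  ∃ l : List B, l.Nodup ∧ (∀ i : B, i ∈ l) ∧ (l.map cs.simple).prod = c

/-- A parabolic subgroup: a subgroup conjugate in `W` to the subgroup generated by a
subset of the simple reflections. -/
def IsParabolic (cs : CoxeterSystem M W) (W' : Subgroup W) : Prop :=
  ∃ (w : W) (J : Set B),
    W' = (Subgroup.closure (cs.simple '' J)).map (MulAut.conj w).toMonoidHom

/-- `W'` is noncrossing with respect to `c`: there is an element `x ≤_T c` and a reduced
`T`-word `t₁ ⋯ t_k` for `x` with `W' = ⟨t₁, …, t_k⟩`. -/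
def IsNoncrossing (cs : CoxeterSystem M W) (c : W) (W' : Subgroup W) : Prop :=
  ∃ (x : W) (l : List W), absLe cs x c ∧ (∀ t ∈ l, cs.IsReflection t) ∧
    l.prod = x ∧ l.length = absLength cs x ∧ W' = Subgroup.closure {t : W | t ∈ l}

/-- Absolute length does not increase under a map `f` sending each reflection word with product `w`
to a reflection word of the same length with product `f w`. -/
theorem absLength_le_of_word_map (cs : CoxeterSystem M W) (f : W → W) (F : List W → List W)
    (hrefl : ∀ l, (∀ t ∈ l, cs.IsReflection t) → ∀ t ∈ F l, cs.IsReflection t)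
    (hlen : ∀ l, (F l).length = l.length) (hprod : ∀ l, (F l).prod = f l.prod) (w : W) :
    absLength cs (f w) ≤ absLength cs w := by
  have hne : {k : ℕ | ∃ l : List W, (∀ t ∈ l, cs.IsReflection t) ∧ l.length = k ∧
      l.prod = w}.Nonempty := by
    obtain ⟨ω, rfl⟩ := cs.wordProd_surjective w
    refine ⟨_, ω.map cs.simple, fun t ht ↦ ?_, rfl, rfl⟩
    obtain ⟨i, -, rfl⟩ := List.mem_map.1 ht
    exact cs.isReflection_simple i
  obtain ⟨l, hl, hk, hw⟩ := Nat.sInf_mem hne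
  exact Nat.sInf_le ⟨F l, hrefl l hl, (hlen l).trans hk, by rw [hprod, hw]⟩

theorem List.prod_reverse_of_isReflection (cs : CoxeterSystem M W) (l : List W)
    (hl : ∀ t ∈ l, cs.IsReflection t) : l.reverse.prod = l.prod⁻¹ := by
  rw [List.prod_inv_reverse, List.map_congr_left (g := id) fun t ht ↦ (hl t ht).inv, List.map_id]

theorem absLength_inv_le (cs : CoxeterSystem M W) (w : W) :
    absLength cs w⁻¹ ≤ absLength cs w := by
  refine absLength_le_of_word_map cs (·⁻¹) (fun l ↦ (l.map (·⁻¹)).reverse) (fun l hl t ht ↦ ?_)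
    (by simp) (fun l ↦ (List.prod_inv_reverse l).symm) w
  obtain ⟨s, hs, rfl⟩ := List.mem_map.1 (List.mem_reverse.1 ht)
  rw [(hl s hs).inv]
  exact hl s hs

theorem absLength_inv (cs : CoxeterSystem M W) (w : W) : absLength cs w⁻¹ = absLength cs w :=
  (absLength_inv_le cs w).antisymm (by simpa using absLength_inv_le cs w⁻¹)

theorem absLength_conj_le (cs : CoxeterSystem M W) (g w : W) :
    absLength cs (MulAut.conj g w) ≤ absLength cs w := by
  refine absLength_le_of_word_map cs (MulAut.conj g) (List.map (MulAut.conj g))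
    (fun l hl t ht ↦ ?_) (by simp) (fun l ↦ (map_list_prod _ l).symm) w
  obtain ⟨s, hs, rfl⟩ := List.mem_map.1 ht
  exact (hl s hs).conj g

theorem absLength_conj (cs : CoxeterSystem M W) (g w : W) :
    absLength cs (MulAut.conj g w) = absLength cs w :=
  (absLength_conj_le cs g w).antisymm
    (by simpa [mul_assoc] using absLength_conj_le cs g⁻¹ (MulAut.conj g w))

theorem absLe.conj {cs : CoxeterSystem M W} {u v : W} (h : absLe cs u v) (g : W) :
    absLe cs (MulAut.conj g u) (MulAut.conj g v) := by
  unfold absLe at h ⊢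
  rwa [← map_inv, ← map_mul, absLength_conj, absLength_conj, absLength_conj]

theorem absLe.inv {cs : CoxeterSystem M W} {u v : W} (h : absLe cs u v) :
    absLe cs u⁻¹ v⁻¹ := by
  unfold absLe at h ⊢
  have h' : absLength cs (u⁻¹⁻¹ * v⁻¹) = absLength cs (u⁻¹ * v) := by
    rw [← absLength_inv cs (u⁻¹ * v), ← absLength_conj cs u ((u⁻¹ * v)⁻¹)]
    simp [mul_assoc]
  rwa [h', absLength_inv, absLength_inv]

theorem IsNoncrossing.conj {cs : CoxeterSystem M W} {c : W} {H : Subgroup W}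
    (h : IsNoncrossing cs c H) (g : W) :
    IsNoncrossing cs (MulAut.conj g c) (H.map (MulAut.conj g).toMonoidHom) := by
  obtain ⟨x, l, hx, hl, hprod, hlen, rfl⟩ := h
  refine ⟨MulAut.conj g x, l.map (MulAut.conj g), hx.conj g, fun t ht ↦ ?_, ?_, ?_, ?_⟩
  · obtain ⟨s, hs, rfl⟩ := List.mem_map.1 ht
    exact (hl s hs).conj g
  · rw [← hprod, map_list_prod]
  · rw [List.length_map, hlen, absLength_conj]
  · rw [MonoidHom.map_closure]
    congr 1
    ext t
    simp

theorem IsNoncrossing.inv {cs : CoxeterSystem M W} {c : W} {H : Subgroup W}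
    (h : IsNoncrossing cs c H) : IsNoncrossing cs c⁻¹ H := by
  obtain ⟨x, l, hx, hl, hprod, hlen, rfl⟩ := h
  refine ⟨x⁻¹, l.reverse, hx.inv, fun t ht ↦ hl t (List.mem_reverse.1 ht), ?_, ?_, ?_⟩
  · rw [List.prod_reverse_of_isReflection cs l hl, hprod]
  · rw [List.length_reverse, hlen, absLength_inv]
  · simp

theorem isNoncrossing_iff_of_conj_eq_inv (cs : CoxeterSystem M W) {c g : W} (hg : g * g = 1)
    (hc : g * c * g = c⁻¹) {H K : Subgroup W}
    (hK : (K : Set W) = {x : W | ∃ y ∈ H, x = g * y * g}) :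
    IsNoncrossing cs c H ↔ IsNoncrossing cs c K := by
  have hginv : g⁻¹ = g := inv_eq_of_mul_eq_one_left hg
  have hconj : MulAut.conj g c = c⁻¹ := by rw [MulAut.conj_apply, hginv, hc]
  have step (L : Subgroup W) (h : IsNoncrossing cs c L) :
      IsNoncrossing cs c (L.map (MulAut.conj g).toMonoidHom) := by
    simpa [hconj] using (h.conj g).inv
  have hmap : K = H.map (MulAut.conj g).toMonoidHom := by
    apply SetLike.coe_injective
    rw [hK]
    ext x
    simp [hginv, eq_comm]
  have hmap' : K.map (MulAut.conj g).toMonoidHom = H := by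
    rw [hmap, Subgroup.map_map]
    convert Subgroup.map_id H
    ext y
    simp [hginv, mul_assoc, hg, ← mul_assoc g g]
  exact ⟨fun h ↦ hmap ▸ step H h, fun h ↦ hmap' ▸ step K h⟩

theorem prod_map_simple_mul_self (cs : CoxeterSystem M W) (l : List B)
    (hl : ∀ i ∈ l, ∀ j ∈ l, Commute (cs.simple i) (cs.simple j)) :
    (l.map cs.simple).prod * (l.map cs.simple).prod = 1 := by
  induction l with
  | nil => simp
  | cons a l ih =>
    have hcomm : Commute (cs.simple a) (l.map cs.simple).prod := by
      refine Commute.list_prod_right _ _ fun x hx ↦ ?_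
      obtain ⟨i, hi, rfl⟩ := List.mem_map.1 hx
      exact hl a (by simp) i (by simp [hi])
    rw [List.map_cons, List.prod_cons, hcomm.symm.mul_mul_mul_comm, cs.simple_mul_simple_self,
      one_mul]
    exact ih fun i hi j hj ↦ hl i (by simp [hi]) j (by simp [hj])

/-- For the bipartite Coxeter element `c = c₋ c₊`, conjugation by `c₊` or by
`c₋` preserves the crossing/noncrossing status of parabolic subgroups: a parabolic subgroup
`W'` is noncrossing with respect to `c` iff `c_ε W' c_ε` is. -/
theorem isNoncrossing_conj_bipartite_iff
    (cs : CoxeterSystem M W) [Finite W] [Finite B]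
    (lp lm : List B) (hlpnd : lp.Nodup) (hlmnd : lm.Nodup)
    (hpart : ∀ i : B, i ∈ lp ↔ i ∉ lm)
    (hcommp : ∀ i ∈ lp, ∀ j ∈ lp, Commute (cs.simple i) (cs.simple j))
    (hcommm : ∀ i ∈ lm, ∀ j ∈ lm, Commute (cs.simple i) (cs.simple j))
    (cplus cminus c : W)
    (hcplus : cplus = (lp.map cs.simple).prod)
    (hcminus : cminus = (lm.map cs.simple).prod)
    (hc : c = cminus * cplus)
    (W' : Subgroup W) (hW' : IsParabolic cs W') :
    (∀ W'' : Subgroup W, (W'' : Set W) = {x : W | ∃ y ∈ W', x = cplus * y * cplus} →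
      (IsNoncrossing cs c W' ↔ IsNoncrossing cs c W'')) ∧
    (∀ W'' : Subgroup W, (W'' : Set W) = {x : W | ∃ y ∈ W', x = cminus * y * cminus} →
      (IsNoncrossing cs c W' ↔ IsNoncrossing cs c W'')) := by
  have hp : cplus * cplus = 1 := hcplus ▸ prod_map_simple_mul_self cs lp hcommp
  have hm : cminus * cminus = 1 := hcminus ▸ prod_map_simple_mul_self cs lm hcommm
  have hinv : c⁻¹ = cplus * cminus := by
    rw [hc, mul_inv_rev, inv_eq_of_mul_eq_one_left hp, inv_eq_of_mul_eq_one_left hm]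
  refine ⟨fun _ h ↦ isNoncrossing_iff_of_conj_eq_inv cs hp ?_ h,
    fun _ h ↦ isNoncrossing_iff_of_conj_eq_inv cs hm ?_ h⟩
  · rw [hinv, hc, mul_assoc, mul_assoc, hp, mul_one]
  · rw [hinv, hc, ← mul_assoc, hm, one_mul]
end
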